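/- Let G=(V,E) be a finite triangle-free simple graph and let (J,𝓑,η) be a Markov space such that every complete bipartite subgraph K_{a,b} of G (a,b≥1) is well-measured in η. Then G is well-measured in η. -/

import Mathlib

open MeasureTheory ProbabilityTheory Finset
open scoped ENNReal

variable {V : Type*} [DecidableEq V] {J : Type*} [MeasurableSpace J]

/-- Restriction of a map `↥T → J` to a subset `S ⊆ T` of a finset `T`. -/
def restr (S T : Finset V) (h : S ⊆ T) (x : ↥T → J) : ↥S → J :=
  fun v => x ⟨v.1, h v.2⟩

/-- A family of σ-finite measures `μ S` on `J^S` (for `S ⊆ V`) is a *normalized, decreasing,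
Markovian family* for the graph `G` and the symmetric measure `η` (with marginal
`π = η ∘ fst⁻¹`) if:
* (normalized) `μ {v} = π` for each vertex and `μ {u,v} = η` (under `J^{u,v} ≅ J²`) for each
  edge `uv` of `G`;
* (decreasing) for `S ⊆ T` the marginal of `μ T` on `J^S` is absolutely continuous w.r.t. `μ S`;
* (Markovian) there are disintegration kernels `ν S T : J^S ⤳ J^{T∖S}` of `μ T` over `μ S`
  such that whenever `U, W ⊆ V`, `S = U ∩ W` and no edge of `G` joins `U ∖ S` to `W ∖ S`,
  one has `ν S (U∪W) x = ν S U x × ν S W x` for `μ S`-almost all `x`. -/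
def IsHomMeasureFamily [Fintype V] (G : SimpleGraph V) (η : Measure (J × J))
    (μ : (S : Finset V) → Measure (↥S → J)) : Prop :=
  (∀ S, SigmaFinite (μ S)) ∧
  (∀ v : V, μ {v} = (η.map Prod.fst).map (fun j (_ : ↥({v} : Finset V)) => j)) ∧
  (∀ u v : V, G.Adj u v →
      μ {u, v} = η.map (fun q (w : ↥({u, v} : Finset V)) => if (w : V) = u then q.1 else q.2)) ∧
  (∀ (S T : Finset V) (h : S ⊆ T), (μ T).map (restr S T h) ≪ μ S) ∧
  (∃ ν : (S : Finset V) → (T : Finset V) → S ⊆ T → Kernel (↥S → J) (↥(T \ S) → J),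
    (∀ (S T : Finset V) (h : S ⊆ T) (A : Set (↥S → J)) (B : Set (↥(T \ S) → J)),
        MeasurableSet A → MeasurableSet B →
        μ T {x | restr S T h x ∈ A ∧ restr (T \ S) T sdiff_subset x ∈ B}
          = ∫⁻ x in A, ν S T h x B ∂(μ S)) ∧
    (∀ U W : Finset V,
        (∀ u ∈ U \ (U ∩ W), ∀ w ∈ W \ (U ∩ W), ¬ G.Adj u w) →
        ∀ᵐ x ∂(μ (U ∩ W)),
          (ν (U ∩ W) (U ∪ W) inter_subset_union x).map
            (fun y => (restr (U \ (U ∩ W)) ((U ∪ W) \ (U ∩ W))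
                          (sdiff_subset_sdiff subset_union_left le_rfl) y,
                       restr (W \ (U ∩ W)) ((U ∪ W) \ (U ∩ W))
                          (sdiff_subset_sdiff subset_union_right le_rfl) y))
            = (ν (U ∩ W) U inter_subset_left x).prod (ν (U ∩ W) W inter_subset_right x)))

/-- A finite simple graph `G` is *well-measured* in the Markov space `η` if a normalized,
decreasing, Markovian family of σ-finite measures exists. -/
def WellMeasured [Fintype V] (G : SimpleGraph V) (η : Measure (J × J)) : Prop :=
  ∃ μ : (S : Finset V) → Measure (↥S → J), IsHomMeasureFamily G η μ

/-- `G` is well-measured in `η` *with finite density* if moreover the witnessing family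
consists of finite measures. -/
def WellMeasuredFinite [Fintype V] (G : SimpleGraph V) (η : Measure (J × J)) : Prop :=
  ∃ μ : (S : Finset V) → Measure (↥S → J),
    IsHomMeasureFamily G η μ ∧ ∀ S, IsFiniteMeasure (μ S)

set_option linter.unusedSectionVars false

theorem isSFiniteKernel_of_forall_isFiniteMeasure {α β : Type*} [MeasurableSpace α]
    [MeasurableSpace β] (κ : Kernel α β) (h : ∀ x, IsFiniteMeasure (κ x)) :
    IsSFiniteKernel κ := by
  classical
  have hm : Measurable fun x => κ x Set.univ := κ.measurable_coe MeasurableSet.univ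
  let E : ℕ → Set α := fun n => {x | (n : ℝ≥0∞) ≤ κ x Set.univ ∧ κ x Set.univ < n + 1}
  have hE : ∀ n, MeasurableSet (E n) := fun n =>
    (measurableSet_le measurable_const hm).inter (measurableSet_lt hm measurable_const)
  have hfin : ∀ n, IsFiniteKernel (Kernel.piecewise (hE n) κ 0) := by
    intro n
    refine ⟨⟨(n : ℝ≥0∞) + 1, by simp, fun x => ?_⟩⟩
    rw [Kernel.piecewise_apply]
    split_ifs with hx
    · exact hx.2.le
    · simp
  have hsum : κ = Kernel.sum fun n => Kernel.piecewise (hE n) κ 0 := by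
    ext x s hs
    rw [Kernel.sum_apply' _ _ hs]
    obtain ⟨n, hn⟩ : ∃ n, x ∈ E n := by
      have hx : κ x Set.univ ≠ ∞ := measure_ne_top _ _
      refine ⟨⌊(κ x Set.univ).toReal⌋₊, ?_, ?_⟩
      · rw [← ENNReal.ofReal_toReal hx, ← ENNReal.ofReal_natCast]
        exact ENNReal.ofReal_le_ofReal
          (by simpa using Nat.floor_le ENNReal.toReal_nonneg)
      · have := Nat.lt_floor_add_one (κ x Set.univ).toReal
        rw [← ENNReal.toReal_lt_toReal hx (by simp)]
        rw [ENNReal.toReal_add (by simp) (by simp)]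
        simpa using this
    rw [tsum_eq_single n]
    · rw [Kernel.piecewise_apply, if_pos hn]
    · intro m hmn
      rw [Kernel.piecewise_apply, if_neg]
      · simp
      · intro hmE
        apply hmn
        have h1 : (n : ℝ≥0∞) < m + 1 := hn.1.trans_lt hmE.2
        have h2 : (m : ℝ≥0∞) < n + 1 := hmE.1.trans_lt hn.2
        norm_cast at h1 h2
        omega
  rw [hsum]
  exact Kernel.isSFiniteKernel_sum

/-- The kernel sending `x` to the power measure `(ρ x)^κ`, for a kernel `ρ` into finite measures. -/
noncomputable def piKernel {α : Type*} [MeasurableSpace α] (κ : Type*) [Fintype κ]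
    (ρ : Kernel α J) (h : ∀ x, IsFiniteMeasure (ρ x)) : Kernel α (κ → J) where
  toFun x := Measure.pi fun _ => ρ x
  measurable' := by
    refine Measurable.measure_of_isPiSystem generateFrom_pi.symm isPiSystem_pi ?_ ?_
    · rintro _ ⟨s, hs, rfl⟩
      simp only [Measure.pi_pi]
      exact Finset.measurable_prod _ fun i _ => ρ.measurable_coe (hs i (Set.mem_univ i))
    · simp only [Measure.pi_univ]
      exact Finset.measurable_prod _ fun i _ => ρ.measurable_coe MeasurableSet.univ

theorem piKernel_apply {α : Type*} [MeasurableSpace α] (κ : Type*) [Fintype κ]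
    (ρ : Kernel α J) (h : ∀ x, IsFiniteMeasure (ρ x)) (x : α) :
    piKernel κ ρ h x = Measure.pi fun _ => ρ x := rfl

instance {α : Type*} [MeasurableSpace α] (κ : Type*) [Fintype κ]
    (ρ : Kernel α J) (h : ∀ x, IsFiniteMeasure (ρ x)) : IsSFiniteKernel (piKernel κ ρ h) :=
  isSFiniteKernel_of_forall_isFiniteMeasure _ fun x => by
    rw [piKernel_apply]; infer_instance

/-- `ρ` disintegrates the star measure `∫ π(dy) (P_y)^ι ⊗ δ_y` over the power `π^ι`. -/
structure IsStarKernel {ι : Type*} [Fintype ι] (π : Measure J) (P : Kernel J J)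
    (ρ : Kernel (ι → J) J) : Prop where
  finite : ∀ x, IsFiniteMeasure (ρ x)
  setLIntegral_eq : ∀ (A : ι → Set J) (B : Set J), (∀ i, MeasurableSet (A i)) → MeasurableSet B →
    ∫⁻ x in Set.univ.pi A, ρ x B ∂(Measure.pi fun _ => π) = ∫⁻ y in B, ∏ i, P y (A i) ∂π

/-- The iterated star constructions over the two sides of a complete bipartite graph agree. -/
def BipartiteSymm (π : Measure J) (P : Kernel J J) (ι κ : Type*) [Fintype ι] [Fintype κ] : Prop :=
  ∀ (ρ : Kernel (ι → J) J) (ρ' : Kernel (κ → J) J), IsStarKernel π P ρ → IsStarKernel π P ρ' →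
    ∀ f : (ι → J) × (κ → J) → ℝ≥0∞, Measurable f →
      ∫⁻ x, ∫⁻ y, f (x, y) ∂(Measure.pi fun _ => ρ x) ∂(Measure.pi fun _ => π) =
        ∫⁻ y, ∫⁻ x, f (x, y) ∂(Measure.pi fun _ => ρ' y) ∂(Measure.pi fun _ => π)

theorem measurePreserving_comp_equiv {ι ι' : Type*} [Fintype ι] [Fintype ι'] (e : ι ≃ ι')
    (μ : Measure J) [SigmaFinite μ] :
    MeasurePreserving (fun (x : ι' → J) (i : ι) => x (e i)) (Measure.pi fun _ => μ)
      (Measure.pi fun _ => μ) := by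
  have hm : Measurable fun (x : ι' → J) (i : ι) => x (e i) := by fun_prop
  refine ⟨hm, (Measure.pi_eq fun s hs => ?_).symm⟩
  rw [Measure.map_apply hm (MeasurableSet.univ_pi hs)]
  have : (fun (x : ι' → J) (i : ι) => x (e i)) ⁻¹' Set.univ.pi s
      = Set.univ.pi fun i' => s (e.symm i') := by
    ext x
    simp only [Set.mem_preimage, Set.mem_univ_pi]
    exact ⟨fun h i' => by simpa using h (e.symm i'), fun h i => by simpa using h (e i)⟩
  rw [this, Measure.pi_pi]
  exact Equiv.prod_comp e.symm fun i => μ (s i)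

theorem IsStarKernel.comap_equiv {ι ι' : Type*} [Fintype ι] [Fintype ι'] (e : ι ≃ ι')
    {π : Measure J} [SigmaFinite π] {P : Kernel J J} {ρ : Kernel (ι → J) J}
    (h : IsStarKernel π P ρ) :
    IsStarKernel π P (ρ.comap (fun (x : ι' → J) (i : ι) => x (e i))
      (measurable_pi_lambda _ fun _ => measurable_pi_apply _)) where
  finite x := h.finite _
  setLIntegral_eq A B hA hB := by
    have := h.setLIntegral_eq (fun i => A (e i)) B (fun i => hA _) hB
    simp only [Kernel.comap_apply]
    rw [← (measurePreserving_comp_equiv e π).setLIntegral_comp_preimage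
      (MeasurableSet.univ_pi fun _ => hA _) (ρ.measurable_coe hB)] at this
    have hpre : (fun (x : ι' → J) (i : ι) => x (e i)) ⁻¹' Set.univ.pi (fun i => A (e i))
        = Set.univ.pi A := by
      ext x
      simp only [Set.mem_preimage, Set.mem_univ_pi]
      exact ⟨fun h i' => by simpa using h (e.symm i'), fun h i => h (e i)⟩
    rw [hpre] at this
    rw [this]
    refine lintegral_congr fun y => ?_
    exact Equiv.prod_comp e fun i => P y (A i)

theorem BipartiteSymm.of_equiv {ι ι' κ κ' : Type*} [Fintype ι] [Fintype ι'] [Fintype κ]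
    [Fintype κ'] (e : ι ≃ ι') (e' : κ ≃ κ') {π : Measure J} [SigmaFinite π] {P : Kernel J J}
    (h : BipartiteSymm π P ι κ) : BipartiteSymm π P ι' κ' := by
  intro ρ ρ' hρ hρ' f hf
  have key := h _ _ (hρ.comap_equiv e.symm) (hρ'.comap_equiv e'.symm)
    (fun p => f (fun i => p.1 (e.symm i), fun i => p.2 (e'.symm i)))
    (hf.comp (by fun_prop))
  have h1 := measurePreserving_comp_equiv e.symm π
  have h2 := measurePreserving_comp_equiv e'.symm π
  have := hρ.finite
  have := hρ'.finite
  simp only [Kernel.comap_apply] at key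
  have meas1 : Measurable fun x : ι' → J => ∫⁻ y, f (x, y) ∂(Measure.pi fun _ : κ' => ρ x) :=
    hf.lintegral_kernel_prod_right' (κ := piKernel κ' ρ hρ.finite)
  have meas2 : Measurable fun y : κ' → J => ∫⁻ x, f (x, y) ∂(Measure.pi fun _ : ι' => ρ' y) :=
    (hf.comp measurable_swap).lintegral_kernel_prod_right' (κ := piKernel ι' ρ' hρ'.finite)
  rw [← h1.lintegral_comp meas1, ← h2.lintegral_comp meas2]
  convert key using 4 with x y
  · exact ((measurePreserving_comp_equiv e'.symm (ρ fun i => x (e.symm i))).lintegral_comp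
      (hf.comp measurable_prodMk_left)).symm
  · exact ((measurePreserving_comp_equiv e.symm (ρ' fun i => y (e'.symm i))).lintegral_comp
      (hf.comp measurable_prodMk_right)).symm

/-- The product set `∏_{v ∈ S} B v` in `J^S`. -/
def finsetBox (S : Finset V) (B : V → Set J) : Set (↥S → J) := Set.univ.pi fun v => B v

theorem mem_box {S : Finset V} {B : V → Set J} {x : ↥S → J} :
    x ∈ finsetBox S B ↔ ∀ v (h : v ∈ S), x ⟨v, h⟩ ∈ B v := by
  simp [finsetBox]

theorem measurableSet_box {S : Finset V} {B : V → Set J} (hB : ∀ v, MeasurableSet (B v)) :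
    MeasurableSet (finsetBox S B) := MeasurableSet.univ_pi fun v => hB v

theorem exists_box_eq {S : Finset V} {s : ↥S → Set J} (hs : ∀ v, MeasurableSet (s v)) :
    ∃ B : V → Set J, (∀ v, MeasurableSet (B v)) ∧ ∀ v : ↥S, B v = s v := by
  refine ⟨fun v => if h : v ∈ S then s ⟨v, h⟩ else Set.univ, fun v => ?_, fun v => by simp⟩
  dsimp only
  split_ifs with h
  exacts [hs _, MeasurableSet.univ]

theorem measurable_restr {S T : Finset V} (h : S ⊆ T) :
    Measurable (restr S T h : (↥T → J) → (↥S → J)) := by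
  unfold restr; fun_prop

/-- The kernels `ν S T` disintegrate `μ T` over `μ S`. -/
def Disintegrates (μ : (S : Finset V) → Measure (↥S → J))
    (ν : (S : Finset V) → (T : Finset V) → S ⊆ T → Kernel (↥S → J) (↥(T \ S) → J)) : Prop :=
  ∀ (S T : Finset V) (h : S ⊆ T) (A : Set (↥S → J)) (B : Set (↥(T \ S) → J)),
    MeasurableSet A → MeasurableSet B →
    μ T {x | restr S T h x ∈ A ∧ restr (T \ S) T sdiff_subset x ∈ B}
      = ∫⁻ x in A, ν S T h x B ∂(μ S)

/-- Kernels over `U ∩ W` split as products whenever no edge joins `U` to `W` outside `U ∩ W`. -/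
def IsMarkovFamily (G : SimpleGraph V) (μ : (S : Finset V) → Measure (↥S → J))
    (ν : (S : Finset V) → (T : Finset V) → S ⊆ T → Kernel (↥S → J) (↥(T \ S) → J)) : Prop :=
  ∀ U W : Finset V,
    (∀ u ∈ U \ (U ∩ W), ∀ w ∈ W \ (U ∩ W), ¬ G.Adj u w) →
    ∀ᵐ x ∂(μ (U ∩ W)),
      (ν (U ∩ W) (U ∪ W) inter_subset_union x).map
        (fun y => (restr (U \ (U ∩ W)) ((U ∪ W) \ (U ∩ W))
                      (sdiff_subset_sdiff subset_union_left le_rfl) y,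
                   restr (W \ (U ∩ W)) ((U ∪ W) \ (U ∩ W))
                      (sdiff_subset_sdiff subset_union_right le_rfl) y))
        = (ν (U ∩ W) U inter_subset_left x).prod (ν (U ∩ W) W inter_subset_right x)

section family

variable {G : SimpleGraph V} {μ : (S : Finset V) → Measure (↥S → J)}
  {ν : (S : Finset V) → (T : Finset V) → S ⊆ T → Kernel (↥S → J) (↥(T \ S) → J)}

theorem IsMarkovFamily.apply_box (hν : IsMarkovFamily G μ ν) {S U W T : Finset V}
    (hS : U ∩ W = S) (hT : U ∪ W = T) (hSU : S ⊆ U) (hSW : S ⊆ W) (hST : S ⊆ T)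
    (hadj : ∀ u ∈ U \ S, ∀ w ∈ W \ S, ¬ G.Adj u w) :
    ∀ᵐ x ∂μ S, IsFiniteMeasure (ν S W hSW x) → ∀ B : V → Set J, (∀ v, MeasurableSet (B v)) →
      ν S T hST x (finsetBox (T \ S) B) =
        ν S U hSU x (finsetBox (U \ S) B) * ν S W hSW x (finsetBox (W \ S) B) := by
  subst hS hT
  filter_upwards [hν U W hadj] with x hx hfin B hB
  rw [← Measure.prod_prod, ← hx, Measure.map_apply]
  · congr 1
    ext y
    simp only [Set.mem_preimage, Set.mem_prod, mem_box, restr]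
    constructor
    · exact fun h => ⟨fun v hv => h v _, fun v hv => h v _⟩
    · rintro ⟨h1, h2⟩ v hv
      rw [mem_sdiff, mem_union] at hv
      rcases hv.1 with h | h
      · exact h1 v (mem_sdiff.2 ⟨h, hv.2⟩)
      · exact h2 v (mem_sdiff.2 ⟨h, hv.2⟩)
  · exact (measurable_restr _).prodMk (measurable_restr _)
  · exact (measurableSet_box hB).prod (measurableSet_box hB)

theorem Disintegrates.ae_isFiniteMeasure (hμ : Disintegrates μ ν) {S T : Finset V} (h : S ⊆ T)
    (hT : μ T Set.univ ≠ ∞) : ∀ᵐ x ∂μ S, IsFiniteMeasure (ν S T h x) := by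
  have := hμ S T h Set.univ Set.univ MeasurableSet.univ MeasurableSet.univ
  simp only [Set.mem_univ, and_self, Set.ofPred_true, Measure.restrict_univ] at this
  rw [this] at hT
  filter_upwards [ae_lt_top ((ν S T h).measurable_coe MeasurableSet.univ) hT] with x hx
  exact ⟨hx⟩

theorem IsMarkovFamily.apply_box_of_pairwise (hν : IsMarkovFamily G μ ν) {S : Finset V}
    {D : Finset V} (hD : D.Nonempty) (hSD : Disjoint S D)
    (hind : ∀ u ∈ D, ∀ w ∈ D, ¬ G.Adj u w)
    (hfin : ∀ d ∈ D, ∀ᵐ x ∂μ S, IsFiniteMeasure (ν S (insert d S) (subset_insert _ _) x)) :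
    ∀ᵐ x ∂μ S, ∀ B : V → Set J, (∀ v, MeasurableSet (B v)) →
      ν S (S ∪ D) subset_union_left x (finsetBox ((S ∪ D) \ S) B) =
        ∏ d ∈ D, ν S (insert d S) (subset_insert _ _) x (finsetBox (insert d S \ S) B) := by
  induction D using Finset.induction_on with
  | empty => simp at hD
  | insert d D hd ih =>
    rcases D.eq_empty_or_nonempty with rfl | hDne
    · refine Filter.Eventually.of_forall fun x B hB => ?_
      have : ∀ T (h : S ⊆ T), T = insert d S → ν S T h x (finsetBox (T \ S) B) =
          ν S (insert d S) (subset_insert _ _) x (finsetBox (insert d S \ S) B) := by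
        rintro _ _ rfl; rfl
      rw [insert_empty_eq, prod_singleton]
      exact this _ _ (union_comm _ _)
    rw [disjoint_insert_right] at hSD
    have ih' := ih hDne hSD.2
      (fun u hu w hw => hind u (mem_insert_of_mem hu) w (mem_insert_of_mem hw))
      (fun e he => hfin e (mem_insert_of_mem he))
    have hm := hν.apply_box (S := S) (U := S ∪ D) (W := insert d S) (T := S ∪ insert d D)
      (by ext v; simp only [mem_inter, mem_union, mem_insert]; grind)
      (by ext v; simp only [mem_union, mem_insert]; tauto)
      subset_union_left (subset_insert _ _) subset_union_left
      (by
        intro u hu w hw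
        apply hind <;> grind)
    filter_upwards [ih', hm, hfin d (mem_insert_self _ _)] with x h1 h2 h3 B hB
    rw [prod_insert hd, h2 h3 B hB, h1 B hB, mul_comm]

theorem Disintegrates.apply_of_pairwise (hμ : Disintegrates μ ν) (hν : IsMarkovFamily G μ ν)
    {S : Finset V}
    {D : Finset V} (hD : D.Nonempty) (hSD : Disjoint S D)
    (hind : ∀ u ∈ D, ∀ w ∈ D, ¬ G.Adj u w)
    (hfin : ∀ d ∈ D, μ (insert d S) Set.univ ≠ ∞)
    {A : Set (↥S → J)} (hA : MeasurableSet A) {B : V → Set J} (hB : ∀ v, MeasurableSet (B v)) :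
    μ (S ∪ D) {x | restr S (S ∪ D) subset_union_left x ∈ A ∧
        restr D (S ∪ D) subset_union_right x ∈ finsetBox D B} =
      ∫⁻ x in A, ∏ d ∈ D,
        ν S (insert d S) (subset_insert _ _) x (finsetBox (insert d S \ S) B) ∂μ S := by
  have key := hν.apply_box_of_pairwise hD hSD hind
    (fun d hd => hμ.ae_isFiniteMeasure _ (hfin d hd))
  rw [← lintegral_congr_ae (ae_restrict_of_ae (key.mono fun x hx => hx B hB)),
    ← hμ _ _ _ _ _ hA (measurableSet_box hB)]
  congr 1
  ext x
  simp only [Set.mem_ofPred_eq, mem_box, restr]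
  refine and_congr_right fun _ => ⟨fun h v hv => h v ?_, fun h v hv => h v ?_⟩
  · simp only [mem_sdiff, mem_union] at hv; tauto
  · simp only [mem_sdiff, mem_union]
    exact ⟨Or.inr hv, fun h => Finset.disjoint_left.1 hSD h hv⟩

end family

section family

variable {G : SimpleGraph V} {μ : (S : Finset V) → Measure (↥S → J)}
  {ν : (S : Finset V) → (T : Finset V) → S ⊆ T → Kernel (↥S → J) (↥(T \ S) → J)}

theorem measure_pi_ext_of_box {S : Finset V} {m m' : Measure (↥S → J)} [IsFiniteMeasure m]
    (h : ∀ B : V → Set J, (∀ v, MeasurableSet (B v)) → m (finsetBox S B) = m' (finsetBox S B)) :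
    m = m' := by
  refine ext_of_generate_finite _ generateFrom_pi.symm isPiSystem_pi ?_ ?_
  · rintro _ ⟨s, hs, rfl⟩
    obtain ⟨B, hB, hBs⟩ := exists_box_eq fun v => hs v (Set.mem_univ v)
    have : finsetBox S B = Set.univ.pi s := by simp [finsetBox, hBs]
    rw [← this, h B hB]
  · have := h (fun _ => Set.univ) fun _ => MeasurableSet.univ
    simpa [finsetBox] using this

variable {π : Measure J} [IsProbabilityMeasure π]

theorem mass_empty_ne_zero (hμ : Disintegrates μ ν)
    (hsingle : ∀ v, μ {v} = π.map fun j _ => j) (v : V) : μ ∅ Set.univ ≠ 0 := by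
  intro h0
  have := hμ ∅ {v} (empty_subset _) Set.univ Set.univ MeasurableSet.univ MeasurableSet.univ
  rw [Measure.measure_univ_eq_zero.1 h0, hsingle] at this
  have hm : Measurable fun (j : J) (_ : ↥({v} : Finset V)) => j := by fun_prop
  simp [Measure.map_apply hm MeasurableSet.univ] at this

theorem apply_empty_singleton (hμ : Disintegrates μ ν)
    (hsingle : ∀ v, μ {v} = π.map fun j _ => j) (hc : μ ∅ Set.univ ≠ ∞) (v : V)
    (x : ↥(∅ : Finset V) → J) (B : V → Set J) (hB : ∀ v, MeasurableSet (B v)) :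
    ν ∅ (insert v ∅) (subset_insert _ _) x (finsetBox (insert v ∅ \ ∅) B) =
      (μ ∅ Set.univ)⁻¹ * π (B v) := by
  have hc0 := mass_empty_ne_zero hμ hsingle v
  have := hμ ∅ (insert v ∅) (subset_insert _ _) Set.univ (finsetBox (insert v ∅ \ ∅) B)
    MeasurableSet.univ (measurableSet_box hB)
  have hm : Measurable fun (j : J) (_ : ↥({v} : Finset V)) => j := by fun_prop
  have hset : {y | restr ∅ (insert v ∅) (subset_insert _ _) y ∈ Set.univ ∧
      restr (insert v ∅ \ ∅) (insert v ∅) sdiff_subset y ∈ finsetBox (insert v ∅ \ ∅) B} =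
      finsetBox (insert v ∅) B := by
    ext y
    simp only [mem_box, restr, Set.mem_univ, true_and, Set.mem_ofPred_eq]
    exact ⟨fun h v hv => h v (by simpa using hv), fun h v hv => h v _⟩
  have hins : ∀ T, T = {v} → μ T (finsetBox T B) = μ {v} (finsetBox {v} B) := by
    rintro _ rfl; rfl
  rw [hset, Measure.restrict_univ, lintegral_unique, Subsingleton.elim default x,
    hins _ (insert_empty_eq v), hsingle, Measure.map_apply hm (measurableSet_box hB)] at this
  have hpre : (fun (j : J) (_ : ↥({v} : Finset V)) => j) ⁻¹' finsetBox {v} B = B v := by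
    ext j; simp [mem_box]
  rw [hpre] at this
  rw [this, mul_comm, mul_assoc, ENNReal.mul_inv_cancel hc0 hc, mul_one]

theorem eq_smul_pi_of_pairwise (hμ : Disintegrates μ ν) (hν : IsMarkovFamily G μ ν)
    (hsingle : ∀ v, μ {v} = π.map fun j _ => j) (hc : μ ∅ Set.univ ≠ ∞) {D : Finset V}
    (hD : D.Nonempty) (hind : ∀ u ∈ D, ∀ w ∈ D, ¬ G.Adj u w) :
    μ D = (μ ∅ Set.univ * (μ ∅ Set.univ)⁻¹ ^ D.card) • Measure.pi fun _ => π := by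
  set c := μ ∅ Set.univ with hcdef
  obtain ⟨v, hv⟩ := hD
  have hc0 : c ≠ 0 := mass_empty_ne_zero hμ hsingle v
  have : IsFiniteMeasure ((c * c⁻¹ ^ D.card) • (Measure.pi fun _ : ↥D => π)) :=
    Measure.smul_finite _ (ENNReal.mul_ne_top hc (ENNReal.pow_ne_top (ENNReal.inv_ne_top.2 hc0)))
  refine (measure_pi_ext_of_box fun B hB => ?_).symm
  have h1 := hμ.apply_of_pairwise hν (S := ∅) ⟨v, hv⟩ (disjoint_empty_left _) hind
    (fun d _ => by
      have hm : Measurable fun (j : J) (_ : ↥({d} : Finset V)) => j := by fun_prop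
      rw [insert_empty_eq, hsingle, Measure.map_apply hm MeasurableSet.univ]
      simp) MeasurableSet.univ hB
  have hset : ∀ T (h : T = D) (h1 : ∅ ⊆ T) (h2 : D ⊆ T), μ T {x | restr ∅ T h1 x ∈ Set.univ ∧
      restr D T h2 x ∈ finsetBox D B} = μ D (finsetBox D B) := by
    rintro _ rfl _ _
    simp only [Set.mem_univ, true_and]
    rfl
  rw [hset _ (empty_union _)] at h1
  rw [h1]
  simp_rw [apply_empty_singleton hμ hsingle hc _ _ B hB]
  rw [lintegral_const, Measure.restrict_apply_univ, prod_mul_distrib, prod_const, mul_right_comm,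
    mul_comm _ (μ ∅ Set.univ), Measure.smul_apply, finsetBox, Measure.pi_pi, smul_eq_mul]
  congr 1
  exact Finset.prod_coe_sort D fun v => π (B v)

variable {P : Kernel J J} {η : Measure (J × J)} [IsProbabilityMeasure η]

theorem ae_apply_edge (hμ : Disintegrates μ ν)
    (hsingle : ∀ v, μ {v} = π.map fun j _ => j)
    (hedge : ∀ u v : V, G.Adj u v →
      μ {u, v} = η.map (fun q (w : ↥({u, v} : Finset V)) => if (w : V) = u then q.1 else q.2))
    (hη : ∀ A B, MeasurableSet A → MeasurableSet B → η (B ×ˢ A) = ∫⁻ x in A, P x B ∂π)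
    {b d : V} (hbd : G.Adj b d) (B : V → Set J) (hB : ∀ v, MeasurableSet (B v)) :
    ∀ᵐ x ∂μ {b}, ν {b} (insert d {b}) (subset_insert _ _) x (finsetBox (insert d {b} \ {b}) B) =
      P (x ⟨b, mem_singleton_self b⟩) (B d) := by
  have hm : Measurable fun (j : J) (_ : ↥({b} : Finset V)) => j := by fun_prop
  have : IsProbabilityMeasure (μ {b}) := by
    rw [hsingle]; exact Measure.isProbabilityMeasure_map hm.aemeasurable
  have hPm : Measurable fun x : ↥({b} : Finset V) → J =>
      P (x ⟨b, mem_singleton_self b⟩) (B d) :=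
    (P.measurable_coe (hB d)).comp (measurable_pi_apply _)
  refine ae_eq_of_forall_setLIntegral_eq_of_sigmaFinite
    (Kernel.measurable_coe _ (measurableSet_box hB)) hPm
    fun A hA _ => ?_
  rw [← hμ _ _ _ _ _ hA (measurableSet_box hB), hsingle, setLIntegral_map hA hPm hm]
  rw [← hη _ _ (hm hA) (hB d), hedge d b hbd.symm, Measure.map_apply]
  · congr 1
    ext q
    have hne : b ≠ d := hbd.ne
    simp only [restr, mem_box, Set.preimage_ofPred_eq, Set.mem_ofPred_eq, Set.mem_prod,
      Set.mem_preimage]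
    rw [and_comm]
    refine and_congr ⟨fun h => by simpa using h d (by simp [hne.symm]), fun h v hv => ?_⟩ ?_
    · have : v = d := by simp at hv; tauto
      subst this; simpa using h
    · refine iff_of_eq (congrArg (· ∈ A) ?_)
      ext v
      show (if (v : V) = d then q.1 else q.2) = q.2
      rw [if_neg]
      rw [mem_singleton.1 v.2]; exact hne
  · refine measurable_pi_lambda _ fun v => ?_
    split_ifs <;> fun_prop
  · exact (measurable_restr _ hA).inter (measurable_restr _ (measurableSet_box hB))

theorem apply_star (hμ : Disintegrates μ ν) (hν : IsMarkovFamily G μ ν)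
    (hsingle : ∀ v, μ {v} = π.map fun j _ => j)
    (hedge : ∀ u v : V, G.Adj u v →
      μ {u, v} = η.map (fun q (w : ↥({u, v} : Finset V)) => if (w : V) = u then q.1 else q.2))
    (hη : ∀ A B, MeasurableSet A → MeasurableSet B → η (B ×ˢ A) = ∫⁻ x in A, P x B ∂π)
    {b : V} {A : Finset V} (hA : A.Nonempty) (hind : ∀ u ∈ A, ∀ w ∈ A, ¬ G.Adj u w)
    (hadj : ∀ a ∈ A, G.Adj b a) (B : V → Set J) (hB : ∀ v, MeasurableSet (B v)) :
    μ (insert b A) (finsetBox (insert b A) B) = ∫⁻ y in B b, ∏ a ∈ A, P y (B a) ∂π := by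
  have hb : b ∉ A := fun h => (hadj b h).ne rfl
  have h1 := hμ.apply_of_pairwise hν (S := {b}) hA (disjoint_singleton_left.2 hb) hind
    (fun d hd => by
      rw [hedge d b (hadj d hd).symm, Measure.map_apply _ MeasurableSet.univ]
      · simp
      · refine measurable_pi_lambda _ fun v => ?_
        split_ifs <;> fun_prop) (measurableSet_box (S := {b}) hB) hB
  have hset : {x | restr {b} ({b} ∪ A) subset_union_left x ∈ finsetBox {b} B ∧
      restr A ({b} ∪ A) subset_union_right x ∈ finsetBox A B} = finsetBox ({b} ∪ A) B := by
    ext x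
    simp only [mem_box, restr, Set.mem_ofPred_eq]
    constructor
    · rintro ⟨h1, h2⟩ v hv
      rcases mem_union.1 hv with h | h
      exacts [h1 v h, h2 v h]
    · exact fun h => ⟨fun v hv => h v _, fun v hv => h v _⟩
  rw [hset] at h1
  rw [insert_eq, h1]
  have hae : ∀ᵐ x ∂μ {b}, ∀ d ∈ A,
      ν {b} (insert d {b}) (subset_insert _ _) x (finsetBox (insert d {b} \ {b}) B) =
      P (x ⟨b, mem_singleton_self b⟩) (B d) := by
    rw [Filter.eventually_all_finset]
    exact fun d hd => ae_apply_edge hμ hsingle hedge hη (hadj d hd) B hB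
  rw [lintegral_congr_ae (ae_restrict_of_ae (hae.mono fun x hx => Finset.prod_congr rfl hx))]
  have hm : Measurable fun (j : J) (_ : ↥({b} : Finset V)) => j := by fun_prop
  have hPm : Measurable fun x : ↥({b} : Finset V) → J =>
      ∏ d ∈ A, P (x ⟨b, mem_singleton_self b⟩) (B d) :=
    Finset.measurable_prod _ fun d _ => (P.measurable_coe (hB d)).comp (measurable_pi_apply _)
  rw [hsingle, setLIntegral_map (measurableSet_box hB) hPm hm]
  congr 2
  ext j
  simp [mem_box]

theorem setLIntegral_box_star (hμ : Disintegrates μ ν) (hν : IsMarkovFamily G μ ν)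
    (hsingle : ∀ v, μ {v} = π.map fun j _ => j)
    (hedge : ∀ u v : V, G.Adj u v →
      μ {u, v} = η.map (fun q (w : ↥({u, v} : Finset V)) => if (w : V) = u then q.1 else q.2))
    (hη : ∀ A B, MeasurableSet A → MeasurableSet B → η (B ×ˢ A) = ∫⁻ x in A, P x B ∂π)
    {b : V} {A : Finset V} (hA : A.Nonempty) (hind : ∀ u ∈ A, ∀ w ∈ A, ¬ G.Adj u w)
    (hadj : ∀ a ∈ A, G.Adj b a) (B : V → Set J) (hB : ∀ v, MeasurableSet (B v))
    (E : Set J) (hE : MeasurableSet E) :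
    ∫⁻ x in finsetBox A B, ν A (insert b A) (subset_insert _ _) x
      (finsetBox (insert b A \ A) fun _ => E) ∂μ A = ∫⁻ y in E, ∏ a ∈ A, P y (B a) ∂π := by
  have hb : b ∉ A := fun h => (hadj b h).ne rfl
  have hne : ∀ a ∈ A, a ≠ b := fun a ha h => hb (h ▸ ha)
  have h1 := apply_star hμ hν hsingle hedge hη hA hind hadj (Function.update B b E) (by
    intro v
    rcases eq_or_ne v b with rfl | h
    · simpa using hE
    · simpa [h] using hB v)
  have h2 : ∀ y, ∏ a ∈ A, P y (Function.update B b E a) = ∏ a ∈ A, P y (B a) := fun y =>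
    Finset.prod_congr rfl fun a ha => by rw [Function.update_of_ne (hne a ha)]
  simp only [Function.update_self, h2] at h1
  rw [← h1, ← hμ _ _ _ _ _ (measurableSet_box hB) (measurableSet_box fun _ => hE)]
  congr 1
  ext x
  simp only [mem_box, restr, Set.mem_ofPred_eq]
  constructor
  · rintro ⟨h1, h2⟩ v hv
    rcases eq_or_ne v b with rfl | h
    · simpa using h2 v (by simp [hb])
    · simpa [h] using h1 v (by simpa [h] using hv)
  · refine fun h => ⟨fun v hv => ?_, fun v hv => ?_⟩
    · simpa [hne v hv] using h v (mem_insert_of_mem hv)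
    · have : v = b := by simp at hv; tauto
      subst this
      simpa using h v (mem_insert_self _ _)

end family

theorem mul_inv_pow_ne_zero {c : ℝ≥0∞} (h0 : c ≠ 0) (h : c ≠ ∞) (n : ℕ) : c * c⁻¹ ^ n ≠ 0 :=
  mul_ne_zero h0 (pow_ne_zero _ (ENNReal.inv_ne_zero.2 h))

theorem mul_inv_pow_ne_top {c : ℝ≥0∞} (h0 : c ≠ 0) (h : c ≠ ∞) (n : ℕ) : c * c⁻¹ ^ n ≠ ∞ :=
  ENNReal.mul_ne_top h (ENNReal.pow_ne_top (ENNReal.inv_ne_top.2 h0))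

theorem mul_inv_pow_succ {c : ℝ≥0∞} (h0 : c ≠ 0) (h : c ≠ ∞) (n : ℕ) :
    c * c⁻¹ ^ (n + 1) = c⁻¹ ^ n := by
  rw [pow_succ', ← mul_assoc, ENNReal.mul_inv_cancel h0 h, one_mul]

/-- The normalising constant of `K_{a,b}` is symmetric in `a` and `b`. -/
theorem mul_inv_pow_comm {c : ℝ≥0∞} (h0 : c ≠ 0) (h : c ≠ ∞) {a b : ℕ} (ha : a ≠ 0) (hb : b ≠ 0) :
    (c * c⁻¹ ^ a) * (c * c⁻¹ ^ a)⁻¹ ^ b = (c * c⁻¹ ^ b) * (c * c⁻¹ ^ b)⁻¹ ^ a := by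
  obtain ⟨a, rfl⟩ := Nat.exists_eq_succ_of_ne_zero ha
  obtain ⟨b, rfl⟩ := Nat.exists_eq_succ_of_ne_zero hb
  rw [Nat.succ_eq_add_one, Nat.succ_eq_add_one, mul_inv_pow_succ h0 h, mul_inv_pow_succ h0 h,
    mul_inv_pow_succ, mul_inv_pow_succ]
  · simp only [← ENNReal.inv_pow, inv_inv, ← pow_mul, mul_comm]
  all_goals simp [h0, h, ENNReal.pow_eq_top_iff]

section family

variable {G : SimpleGraph V} {μ : (S : Finset V) → Measure (↥S → J)}
  {ν : (S : Finset V) → (T : Finset V) → S ⊆ T → Kernel (↥S → J) (↥(T \ S) → J)}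
  {π : Measure J} [IsProbabilityMeasure π] {P : Kernel J J} {η : Measure (J × J)}
  [IsProbabilityMeasure η]

theorem setLIntegral_pi_box_star (hμ : Disintegrates μ ν) (hν : IsMarkovFamily G μ ν)
    (hsingle : ∀ v, μ {v} = π.map fun j _ => j)
    (hedge : ∀ u v : V, G.Adj u v →
      μ {u, v} = η.map (fun q (w : ↥({u, v} : Finset V)) => if (w : V) = u then q.1 else q.2))
    (hc : μ ∅ Set.univ ≠ ∞)
    (hη : ∀ A B, MeasurableSet A → MeasurableSet B → η (B ×ˢ A) = ∫⁻ x in A, P x B ∂π)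
    {b : V} {A : Finset V} (hA : A.Nonempty) (hind : ∀ u ∈ A, ∀ w ∈ A, ¬ G.Adj u w)
    (hadj : ∀ a ∈ A, G.Adj b a) (B : V → Set J) (hB : ∀ v, MeasurableSet (B v))
    (E : Set J) (hE : MeasurableSet E) :
    ∫⁻ x in finsetBox A B, (μ ∅ Set.univ * (μ ∅ Set.univ)⁻¹ ^ A.card) *
      ν A (insert b A) (subset_insert _ _) x (finsetBox (insert b A \ A) fun _ => E)
        ∂(Measure.pi fun _ => π) = ∫⁻ y in E, ∏ a ∈ A, P y (B a) ∂π := by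
  rw [← setLIntegral_box_star hμ hν hsingle hedge hη hA hind hadj B hB E hE,
    eq_smul_pi_of_pairwise hμ hν hsingle hc hA hind, setLIntegral_smul_measure, smul_eq_mul,
    lintegral_const_mul _ (Kernel.measurable_coe _ (measurableSet_box fun _ => hE))]

theorem exists_isStarKernel (hμ : Disintegrates μ ν) (hν : IsMarkovFamily G μ ν)
    (hsingle : ∀ v, μ {v} = π.map fun j _ => j)
    (hedge : ∀ u v : V, G.Adj u v →
      μ {u, v} = η.map (fun q (w : ↥({u, v} : Finset V)) => if (w : V) = u then q.1 else q.2))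
    (hc : μ ∅ Set.univ ≠ ∞)
    (hη : ∀ A B, MeasurableSet A → MeasurableSet B → η (B ×ˢ A) = ∫⁻ x in A, P x B ∂π)
    [IsMarkovKernel P]
    {b : V} {A : Finset V} (hA : A.Nonempty) (hind : ∀ u ∈ A, ∀ w ∈ A, ¬ G.Adj u w)
    (hadj : ∀ a ∈ A, G.Adj b a) : ∃ ρ : Kernel (↥A → J) J, IsStarKernel π P ρ := by
  classical
  set k := μ ∅ Set.univ * (μ ∅ Set.univ)⁻¹ ^ A.card with hk
  have hb : b ∉ A := fun h => (hadj b h).ne rfl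
  let N : (↥A → J) → Set J → ℝ≥0∞ := fun x E =>
    k * ν A (insert b A) (subset_insert _ _) x (finsetBox (insert b A \ A) fun _ => E)
  have hN : ∀ E, MeasurableSet E → Measurable fun x => N x E := fun E hE =>
    (Kernel.measurable_coe _ (measurableSet_box fun _ => hE)).const_mul _
  have hev : Measurable fun y : ↥(insert b A \ A) → J => y ⟨b, by simp [hb]⟩ :=
    measurable_pi_apply _
  have hpre : ∀ E : Set J, (fun y : ↥(insert b A \ A) → J => y ⟨b, by simp [hb]⟩) ⁻¹' E =
      finsetBox (insert b A \ A) fun _ => E := by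
    intro E
    ext y
    simp only [Set.mem_preimage, mem_box]
    refine ⟨fun h v hv => ?_, fun h => h _ _⟩
    have : v = b := by simp at hv; tauto
    subst this; exact h
  let κ₀ : Kernel (↥A → J) J :=
    { toFun := fun x => k • (ν A (insert b A) (subset_insert _ _) x).map
        fun y => y ⟨b, by simp [hb]⟩
      measurable' := by
        refine Measure.measurable_of_measurable_coe _ fun E hE => ?_
        simp only [Measure.smul_apply, smul_eq_mul, Measure.map_apply hev hE, hpre]
        exact hN E hE }
  have hκ₀ : ∀ x E, MeasurableSet E → κ₀ x E = N x E := by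
    intro x E hE
    show (k • (ν A (insert b A) (subset_insert _ _) x).map _) E = _
    simp only [Measure.smul_apply, smul_eq_mul, Measure.map_apply hev hE, hpre, N]
  have hs : MeasurableSet {x | κ₀ x Set.univ < ∞} :=
    measurableSet_lt (κ₀.measurable_coe MeasurableSet.univ) measurable_const
  have hstar := fun B hB E hE =>
    setLIntegral_pi_box_star hμ hν hsingle hedge hc hη hA hind hadj B hB E hE
  have hae : ∀ᵐ x ∂(Measure.pi fun _ : ↥A => π), κ₀ x Set.univ < ∞ := by
    refine ae_lt_top (κ₀.measurable_coe MeasurableSet.univ) ?_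
    have := hstar (fun _ => Set.univ) (fun _ => MeasurableSet.univ) Set.univ MeasurableSet.univ
    have hu : finsetBox A (fun _ => (Set.univ : Set J)) = Set.univ := by simp [finsetBox]
    rw [hu] at this
    simp only [Measure.restrict_univ, measure_univ, prod_const_one, lintegral_const, mul_one]
      at this
    simp_rw [hκ₀ _ _ MeasurableSet.univ]
    exact ne_of_eq_of_ne this ENNReal.one_ne_top
  refine ⟨Kernel.piecewise hs κ₀ 0, fun x => ?_, fun A' B hA' hB => ?_⟩
  · rw [Kernel.piecewise_apply]
    split_ifs with h
    · exact ⟨h⟩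
    · rw [zero_apply]; infer_instance
  · obtain ⟨B', hB', hBA⟩ := exists_box_eq hA'
    have hbox : Set.univ.pi A' = finsetBox A B' := by simp [finsetBox, hBA]
    have hprod : ∀ y, ∏ i, P y (A' i) = ∏ a ∈ A, P y (B' a) := fun y => by
      rw [← Finset.prod_coe_sort A fun a => P y (B' a)]; simp [hBA]
    simp_rw [hprod]
    rw [hbox, ← hstar B' hB' B hB]
    refine lintegral_congr_ae (ae_restrict_of_ae ?_)
    filter_upwards [hae] with x hx
    rw [Kernel.piecewise_apply, if_pos (by exact hx), hκ₀ x B hB]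

theorem ae_smul_apply_eq (hμ : Disintegrates μ ν) (hν : IsMarkovFamily G μ ν)
    (hsingle : ∀ v, μ {v} = π.map fun j _ => j)
    (hedge : ∀ u v : V, G.Adj u v →
      μ {u, v} = η.map (fun q (w : ↥({u, v} : Finset V)) => if (w : V) = u then q.1 else q.2))
    (hc : μ ∅ Set.univ ≠ ∞)
    (hη : ∀ A B, MeasurableSet A → MeasurableSet B → η (B ×ˢ A) = ∫⁻ x in A, P x B ∂π)
    [IsMarkovKernel P]
    {b : V} {A : Finset V} (hA : A.Nonempty) (hind : ∀ u ∈ A, ∀ w ∈ A, ¬ G.Adj u w)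
    (hadj : ∀ a ∈ A, G.Adj b a) {ρ : Kernel (↥A → J) J} (hρ : IsStarKernel π P ρ)
    (E : Set J) (hE : MeasurableSet E) :
    ∀ᵐ x ∂(Measure.pi fun _ => π), (μ ∅ Set.univ * (μ ∅ Set.univ)⁻¹ ^ A.card) *
      ν A (insert b A) (subset_insert _ _) x (finsetBox (insert b A \ A) fun _ => E) = ρ x E := by
  have hstar := fun B hB =>
    setLIntegral_pi_box_star hμ hν hsingle hedge hc hη hA hind hadj B hB E hE
  have hm : Measurable fun x => (μ ∅ Set.univ * (μ ∅ Set.univ)⁻¹ ^ A.card) *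
      ν A (insert b A) (subset_insert _ _) x (finsetBox (insert b A \ A) fun _ => E) :=
    (Kernel.measurable_coe _ (measurableSet_box fun _ => hE)).const_mul _
  have hfin : ∫⁻ x, (μ ∅ Set.univ * (μ ∅ Set.univ)⁻¹ ^ A.card) *
      ν A (insert b A) (subset_insert _ _) x (finsetBox (insert b A \ A) fun _ => E)
      ∂(Measure.pi fun _ => π) ≠ ∞ := by
    have := hstar (fun _ => Set.univ) (fun _ => MeasurableSet.univ)
    have hu : finsetBox A (fun _ => (Set.univ : Set J)) = Set.univ := by simp [finsetBox]
    rw [hu] at this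
    simp only [Measure.restrict_univ, measure_univ, prod_const_one, lintegral_const, one_mul,
      Measure.restrict_apply_univ] at this
    exact ne_of_eq_of_ne this (measure_ne_top _ _)
  have := isFiniteMeasure_withDensity hfin
  refine (withDensity_eq_iff hm.aemeasurable (ρ.measurable_coe hE).aemeasurable hfin).1 ?_
  refine measure_pi_ext_of_box fun B hB => ?_
  rw [withDensity_apply _ (measurableSet_box hB), withDensity_apply _ (measurableSet_box hB),
    hstar B hB, finsetBox, hρ.setLIntegral_eq _ _ (fun v => hB v) hE]
  refine lintegral_congr fun y => ?_
  exact (Finset.prod_coe_sort A fun a => P y (B a)).symm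

theorem lintegral_restr_union (hμ : Disintegrates μ ν) (hν : IsMarkovFamily G μ ν)
    (hsingle : ∀ v, μ {v} = π.map fun j _ => j)
    (hedge : ∀ u v : V, G.Adj u v →
      μ {u, v} = η.map (fun q (w : ↥({u, v} : Finset V)) => if (w : V) = u then q.1 else q.2))
    (hc : μ ∅ Set.univ ≠ ∞)
    (hη : ∀ A B, MeasurableSet A → MeasurableSet B → η (B ×ˢ A) = ∫⁻ x in A, P x B ∂π)
    [IsMarkovKernel P]
    {A B T : Finset V} (hA : A.Nonempty) (hB : B.Nonempty) (hAB : Disjoint A B)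
    (hindA : ∀ u ∈ A, ∀ w ∈ A, ¬ G.Adj u w) (hindB : ∀ u ∈ B, ∀ w ∈ B, ¬ G.Adj u w)
    (hadj : ∀ b ∈ B, ∀ a ∈ A, G.Adj b a) (hT : A ∪ B = T) (hAT : A ⊆ T) (hBT : B ⊆ T)
    {ρ : Kernel (↥A → J) J} (hρ : IsStarKernel π P ρ)
    {f : (↥A → J) × (↥B → J) → ℝ≥0∞} (hf : Measurable f) :
    ∫⁻ x, f (restr A T hAT x, restr B T hBT x) ∂μ T =
      ((μ ∅ Set.univ * (μ ∅ Set.univ)⁻¹ ^ A.card) *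
        (μ ∅ Set.univ * (μ ∅ Set.univ)⁻¹ ^ A.card)⁻¹ ^ B.card) *
      ∫⁻ x, ∫⁻ y, f (x, y) ∂(Measure.pi fun _ => ρ x) ∂(Measure.pi fun _ => π) := by
  subst hT
  obtain ⟨b₀, hb₀⟩ := id hB
  have hc0 := mass_empty_ne_zero hμ hsingle b₀
  set k := μ ∅ Set.univ * (μ ∅ Set.univ)⁻¹ ^ A.card with hk
  have hk0 : k ≠ 0 := mul_inv_pow_ne_zero hc0 hc _
  have hk1 : k ≠ ∞ := mul_inv_pow_ne_top hc0 hc _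
  have hmAB : Measurable fun x : ↥(A ∪ B) → J => (restr A (A ∪ B) hAT x, restr B (A ∪ B) hBT x) :=
    (measurable_restr _).prodMk (measurable_restr _)
  have := hρ.finite
  suffices h : (μ (A ∪ B)).map (fun x => (restr A (A ∪ B) hAT x, restr B (A ∪ B) hBT x)) =
      (k * k⁻¹ ^ B.card) • ((Measure.pi fun _ => π) ⊗ₘ piKernel ↥B ρ hρ.finite) by
    rw [← lintegral_map hf hmAB, h, lintegral_smul_measure, smul_eq_mul,
      Measure.lintegral_compProd hf]
    rfl
  have hrect : ∀ (s : Set (↥A → J)) (E : V → Set J), MeasurableSet s →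
      (∀ v, MeasurableSet (E v)) →
      (μ (A ∪ B)).map (fun x => (restr A (A ∪ B) hAT x, restr B (A ∪ B) hBT x))
        (s ×ˢ finsetBox B E) = (k * k⁻¹ ^ B.card) * ∫⁻ x in s, ∏ b : ↥B, ρ x (E b)
          ∂(Measure.pi fun _ => π) := by
    intro s E hs hE
    rw [Measure.map_apply hmAB (hs.prod (measurableSet_box hE))]
    have h1 := hμ.apply_of_pairwise hν hB hAB hindB (fun d hd => by
      have hu : finsetBox (insert d A) (fun _ => (Set.univ : Set J)) = Set.univ := by
        simp [finsetBox]
      rw [← hu, apply_star hμ hν hsingle hedge hη hA hindA (hadj d hd) _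
        fun _ => MeasurableSet.univ]
      simp) hs hE
    refine h1.trans ?_
    rw [eq_smul_pi_of_pairwise hμ hν hsingle hc hA hindA, setLIntegral_smul_measure, smul_eq_mul,
      ← hk, mul_assoc k (k⁻¹ ^ B.card)]
    congr 1
    rw [← lintegral_const_mul]
    · refine lintegral_congr_ae (ae_restrict_of_ae ?_)
      have hae : ∀ᵐ x ∂(Measure.pi fun _ : ↥A => π), ∀ b ∈ B, k *
          ν A (insert b A) (subset_insert _ _) x (finsetBox (insert b A \ A) fun _ => E b) =
            ρ x (E b) := by
        rw [Filter.eventually_all_finset]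
        exact fun b hb => ae_smul_apply_eq hμ hν hsingle hedge hc hη hA hindA (hadj b hb) hρ _
          (hE b)
      filter_upwards [hae] with x hx
      rw [Finset.prod_coe_sort B fun b => ρ x (E b), ← prod_const, ← prod_mul_distrib]
      refine Finset.prod_congr rfl fun b hb => ?_
      rw [← hx b hb, ← mul_assoc, ENNReal.inv_mul_cancel hk0 hk1, one_mul]
      congr 1
      ext y
      simp only [mem_box]
      refine forall₂_congr fun v hv => ?_
      have : v = b := by simp at hv; tauto
      rw [congrArg E this]
    · exact Finset.measurable_prod _ fun b _ => ρ.measurable_coe (hE b)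
  have hrect' : ∀ (s : Set (↥A → J)) (E : V → Set J), MeasurableSet s →
      (∀ v, MeasurableSet (E v)) →
      ((k * k⁻¹ ^ B.card) • ((Measure.pi fun _ => π) ⊗ₘ piKernel ↥B ρ hρ.finite))
        (s ×ˢ finsetBox B E) = (k * k⁻¹ ^ B.card) * ∫⁻ x in s, ∏ b : ↥B, ρ x (E b)
          ∂(Measure.pi fun _ => π) := by
    intro s E hs hE
    rw [Measure.smul_apply, smul_eq_mul, Measure.compProd_apply_prod hs (measurableSet_box hE)]
    simp only [piKernel_apply, finsetBox, Measure.pi_pi]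
  have hmass : Measurable fun x => ρ x Set.univ := ρ.measurable_coe MeasurableSet.univ
  refine Measure.ext_of_generateFrom_of_iUnion
    (Set.image2 (· ×ˢ ·) {s : Set (↥A → J) | MeasurableSet s}
      (Set.pi Set.univ '' Set.pi Set.univ fun _ : ↥B => {s : Set J | MeasurableSet s}))
    (fun n : ℕ => {x | ρ x Set.univ ≤ n} ×ˢ Set.univ) ?_ ?_ ?_ ?_ ?_ ?_
  · refine (generateFrom_eq_prod MeasurableSpace.generateFrom_measurableSet generateFrom_pi
      isCountablySpanning_measurableSet ⟨fun _ => Set.univ, fun _ => ?_, ?_⟩).symm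
    · exact ⟨fun _ => Set.univ, fun _ _ => MeasurableSet.univ, by simp⟩
    · exact Set.iUnion_const _
  · exact MeasurableSpace.isPiSystem_measurableSet.prod isPiSystem_pi
  · refine Set.eq_univ_of_forall fun p => ?_
    obtain ⟨n, hn⟩ := ENNReal.exists_nat_gt (measure_ne_top (ρ p.1) Set.univ)
    exact Set.mem_iUnion.2 ⟨n, hn.le, trivial⟩
  · exact fun n => ⟨_, measurableSet_le hmass measurable_const, Set.univ,
      ⟨fun _ => Set.univ, fun _ _ => MeasurableSet.univ, by simp⟩, rfl⟩
  · intro n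
    have hu : (Set.univ : Set (↥B → J)) = finsetBox B fun _ => Set.univ := by simp [finsetBox]
    rw [hu, hrect _ _ (measurableSet_le hmass measurable_const) fun _ => MeasurableSet.univ]
    refine ENNReal.mul_ne_top (ENNReal.mul_ne_top hk1
      (ENNReal.pow_ne_top (ENNReal.inv_ne_top.2 hk0))) (ne_of_lt ?_)
    calc ∫⁻ x in {x | ρ x Set.univ ≤ n}, ∏ b : ↥B, ρ x Set.univ ∂(Measure.pi fun _ => π)
        ≤ ∫⁻ x in {x | ρ x Set.univ ≤ n}, (n : ℝ≥0∞) ^ Fintype.card ↥B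
            ∂(Measure.pi fun _ => π) := by
          refine setLIntegral_mono measurable_const fun x hx => ?_
          rw [prod_const]
          exact pow_le_pow_left' hx _
      _ < ∞ := by
          rw [lintegral_const]
          exact ENNReal.mul_lt_top (ENNReal.pow_lt_top (ENNReal.natCast_lt_top n))
            (measure_lt_top _ _)
  · rintro _ ⟨s, hs, _, ⟨t, ht, rfl⟩, rfl⟩
    obtain ⟨E, hE, hEt⟩ := exists_box_eq fun v => ht v (Set.mem_univ v)
    have : Set.univ.pi t = finsetBox B E := by simp [finsetBox, hEt]
    rw [this]
    exact (hrect s E hs hE).trans (hrect' s E hs hE).symm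

theorem bipartiteSymm_of_family (hμ : Disintegrates μ ν) (hν : IsMarkovFamily G μ ν)
    (hsingle : ∀ v, μ {v} = π.map fun j _ => j)
    (hedge : ∀ u v : V, G.Adj u v →
      μ {u, v} = η.map (fun q (w : ↥({u, v} : Finset V)) => if (w : V) = u then q.1 else q.2))
    (hc : μ ∅ Set.univ ≠ ∞)
    (hη : ∀ A B, MeasurableSet A → MeasurableSet B → η (B ×ˢ A) = ∫⁻ x in A, P x B ∂π)
    [IsMarkovKernel P]
    {A B : Finset V} (hA : A.Nonempty) (hB : B.Nonempty) (hAB : Disjoint A B)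
    (hindA : ∀ u ∈ A, ∀ w ∈ A, ¬ G.Adj u w) (hindB : ∀ u ∈ B, ∀ w ∈ B, ¬ G.Adj u w)
    (hadj : ∀ b ∈ B, ∀ a ∈ A, G.Adj b a) : BipartiteSymm π P ↥A ↥B := by
  intro ρ ρ' hρ hρ' f hf
  have h1 := lintegral_restr_union hμ hν hsingle hedge hc hη hA hB hAB hindA hindB hadj rfl
    subset_union_left subset_union_right hρ hf
  have h2 := lintegral_restr_union hμ hν hsingle hedge hc hη hB hA hAB.symm hindB hindA
    (fun a ha b hb => (hadj b hb a ha).symm) (union_comm B A)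
    subset_union_right subset_union_left hρ' (hf.comp measurable_swap)
  simp only [Function.comp_def, Prod.swap_prod_mk] at h2
  obtain ⟨b₀, hb₀⟩ := id hB
  have hc0 := mass_empty_ne_zero hμ hsingle b₀
  rw [h1, mul_inv_pow_comm hc0 hc hA.card_ne_zero hB.card_ne_zero] at h2
  have hk0 := mul_inv_pow_ne_zero hc0 hc B.card
  have hk1 := mul_inv_pow_ne_top hc0 hc B.card
  exact (ENNReal.mul_right_inj (mul_inv_pow_ne_zero hk0 hk1 _) (mul_inv_pow_ne_top hk0 hk1 _)).1 h2

end family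

theorem WellMeasured.exists_isStarKernel_and_bipartiteSymm {η : Measure (J × J)}
    [IsProbabilityMeasure η] {P : Kernel J J} [IsMarkovKernel P]
    (hη : ∀ A B, MeasurableSet A → MeasurableSet B →
      η (B ×ˢ A) = ∫⁻ x in A, P x B ∂(η.map Prod.fst))
    {a b : ℕ} (ha : 1 ≤ a) (hb : 1 ≤ b)
    (h : WellMeasured (completeBipartiteGraph (Fin a) (Fin b)) η) {ι κ : Type*} [Fintype ι]
    [Fintype κ] (hι : Fintype.card ι = a) (hκ : Fintype.card κ = b) :
    (∃ ρ : Kernel (ι → J) J, IsStarKernel (η.map Prod.fst) P ρ) ∧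
      BipartiteSymm (η.map Prod.fst) P ι κ := by
  obtain ⟨μ, hσ, hsingle, hedge, -, ν, hμ, hν⟩ := h
  have : IsProbabilityMeasure (η.map Prod.fst) :=
    Measure.isProbabilityMeasure_map measurable_fst.aemeasurable
  have hc : μ ∅ Set.univ ≠ ∞ := by
    have hfin : IsFiniteMeasure (μ ∅) := by
      have := hσ ∅
      obtain ⟨n, hn⟩ := Set.mem_iUnion.1 ((iUnion_spanningSets (μ ∅)).symm ▸ Set.mem_univ
        (fun v : ↥(∅ : Finset (Fin a ⊕ Fin b)) => absurd v.2 (notMem_empty _)))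
      have hu : spanningSets (μ ∅) n = Set.univ := Set.eq_univ_of_forall fun x => by
        rwa [Subsingleton.elim x]
      exact ⟨hu ▸ measure_spanningSets_lt_top (μ ∅) n⟩
    exact measure_ne_top _ _
  let A : Finset (Fin a ⊕ Fin b) := univ.map Function.Embedding.inl
  let B : Finset (Fin a ⊕ Fin b) := univ.map Function.Embedding.inr
  have hA : A.Nonempty := ⟨Sum.inl ⟨0, ha⟩, by simp [A]⟩
  have hB : B.Nonempty := ⟨Sum.inr ⟨0, hb⟩, by simp [B]⟩
  have hAB : Disjoint A B := by simp [A, B, Finset.disjoint_left]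
  have hindA : ∀ u ∈ A, ∀ w ∈ A, ¬ (completeBipartiteGraph (Fin a) (Fin b)).Adj u w := by
    simp [A]
  have hindB : ∀ u ∈ B, ∀ w ∈ B, ¬ (completeBipartiteGraph (Fin a) (Fin b)).Adj u w := by
    simp [B]
  have hadj : ∀ v ∈ B, ∀ u ∈ A, (completeBipartiteGraph (Fin a) (Fin b)).Adj v u := by
    simp [A, B]
  have eA : ↥A ≃ ι := Fintype.equivOfCardEq (by
    rw [Fintype.card_coe, card_map, card_univ, Fintype.card_fin, hι])
  have eB : ↥B ≃ κ := Fintype.equivOfCardEq (by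
    rw [Fintype.card_coe, card_map, card_univ, Fintype.card_fin, hκ])
  obtain ⟨v, hv⟩ := id hB
  obtain ⟨ρ, hρ⟩ := exists_isStarKernel hμ hν hsingle hedge hc hη hA hindA (hadj v hv)
  exact ⟨⟨_, hρ.comap_equiv eA⟩, (bipartiteSymm_of_family hμ hν hsingle hedge hc hη hA hB hAB
    hindA hindB hadj).of_equiv eA eB⟩

section sampling

variable (G : SimpleGraph V) [DecidableRel G.Adj] (R : (A : Finset V) → Kernel (↥A → J) J)

/-- Resample the coordinate `v` from the law `R A` given the coordinates in `A`. -/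
noncomputable def sampleStep (v : V) (A : Finset V) : Kernel (V → J) (V → J) :=
  (Kernel.id ×ₖ (R A).comap A.restrict (Finset.measurable_restrict A)).map
    fun p => Function.update p.1 v p.2

/-- Sample the vertices of a list, starting from its last entry, each given its neighbours in `S`
and among the vertices sampled before. -/
noncomputable def sampleList (S : Finset V) : List V → Kernel (V → J) (V → J)
  | [] => Kernel.id
  | v :: l => sampleStep R v ((S ∪ l.toFinset).filter (G.Adj v)) ∘ₖ sampleList S l

variable [hR : ∀ A x, IsFiniteMeasure (R A x)]
variable {G R}

theorem measurable_update_prod (v : V) :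
    Measurable fun p : (V → J) × J => Function.update p.1 v p.2 := by
  refine measurable_pi_lambda _ fun w => ?_
  rcases eq_or_ne w v with rfl | h
  · simpa using measurable_snd
  · simp only [Function.update_of_ne h]
    fun_prop

theorem lintegral_sampleStep (v : V) (A : Finset V) (x : V → J) {f : (V → J) → ℝ≥0∞}
    (hf : Measurable f) :
    ∫⁻ z, f z ∂sampleStep R v A x = ∫⁻ t, f (Function.update x v t) ∂(R A (A.restrict x)) := by
  have : IsSFiniteKernel (R A) := isSFiniteKernel_of_forall_isFiniteMeasure _ (hR A)
  have hm := measurable_update_prod (J := J) v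
  have hfm : Measurable fun p : (V → J) × J => f (Function.update p.1 v p.2) := hf.comp hm
  rw [sampleStep, Kernel.map_apply _ hm, lintegral_map hf hm, Kernel.lintegral_prod _ _ _ hfm,
    Kernel.id_apply, lintegral_dirac' _ hfm.lintegral_prod_right']
  rfl

theorem sampleStep_comm {u w : V} (huw : u ≠ w) {A B : Finset V} (hw : w ∉ A) (hu : u ∉ B) :
    sampleStep R u A ∘ₖ sampleStep R w B = sampleStep R w B ∘ₖ sampleStep R u A := by
  ext1 x
  refine Measure.ext_of_lintegral _ fun f hf => ?_
  have hr : ∀ {v} {C : Finset V}, v ∉ C → ∀ t, C.restrict (Function.update x v t) =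
      C.restrict x := by
    intro v C hv t
    ext ⟨i, hi⟩
    exact Function.update_of_ne (ne_of_mem_of_not_mem hi hv) _ _
  rw [Kernel.lintegral_comp _ _ _ hf, Kernel.lintegral_comp _ _ _ hf,
    lintegral_sampleStep _ _ _ hf.lintegral_kernel, lintegral_sampleStep _ _ _ hf.lintegral_kernel]
  simp_rw [lintegral_sampleStep _ _ _ hf, hr hw, hr hu]
  rw [lintegral_lintegral_swap]
  · simp_rw [Function.update_comm huw]
  · refine (hf.comp (g := f) ?_).aemeasurable
    refine (measurable_update_prod u).comp (Measurable.prodMk ?_ measurable_snd)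
    exact (measurable_update_prod w).comp (measurable_const.prodMk measurable_fst)

theorem lintegral_sampleList_cons (S : Finset V) (v : V) (l : List V) (x : V → J)
    {f : (V → J) → ℝ≥0∞} (hf : Measurable f) :
    ∫⁻ z, f z ∂sampleList G R S (v :: l) x =
      ∫⁻ z, ∫⁻ y, f y ∂sampleStep R v ((S ∪ l.toFinset).filter (G.Adj v)) z
        ∂sampleList G R S l x :=
  Kernel.lintegral_comp _ _ _ hf

theorem sampleStep_comp_sampleList {S : Finset V} {v : V} (hvS : v ∉ S) {l : List V} (hvl : v ∉ l)
    (hadj : ∀ w ∈ l, ¬ G.Adj w v) {A : Finset V} (hA : ∀ w ∈ l, w ∉ A) :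
    sampleStep R v A ∘ₖ sampleList G R S l = sampleList G R S l ∘ₖ sampleStep R v A := by
  induction l with
  | nil => simp [sampleList, Kernel.comp_id, Kernel.id_comp]
  | cons w l ih =>
    simp only [List.mem_cons, not_or, forall_eq_or_imp] at hvl hadj hA
    rw [sampleList, ← Kernel.comp_assoc, sampleStep_comm hvl.1 hA.1, Kernel.comp_assoc,
      ih hvl.2 hadj.2 hA.2, ← Kernel.comp_assoc]
    simp [hvS, hvl.2]

theorem sampleList_eq_comp_filter {S : Finset V} (p : V → Prop) [DecidablePred p] {l : List V}
    (hl : l.Nodup) (hS : ∀ v ∈ l, v ∉ S)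
    (hadj : ∀ u ∈ l, ∀ w ∈ l, p u → ¬ p w → ¬ G.Adj u w) :
    sampleList G R S l =
      sampleList G R S (l.filter p) ∘ₖ sampleList G R S (l.filter fun v => ¬ p v) := by
  induction l with
  | nil => simp [sampleList, Kernel.comp_id]
  | cons v l ih =>
    have ih := ih (List.nodup_cons.1 hl).2 (fun w hw => hS w (List.mem_cons_of_mem _ hw))
      fun u hu w hw => hadj u (List.mem_cons_of_mem _ hu) w (List.mem_cons_of_mem _ hw)
    have hvl := (List.nodup_cons.1 hl).1
    by_cases hp : p v
    · have h : (S ∪ l.toFinset).filter (G.Adj v) =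
          (S ∪ (l.filter p).toFinset).filter (G.Adj v) := by
        ext w
        simp only [mem_filter, mem_union, List.mem_toFinset, List.mem_filter, decide_eq_true_eq]
        refine and_congr_left fun hvw => or_congr_right ⟨fun hw => ⟨hw, ?_⟩, And.left⟩
        by_contra hpw
        exact hadj v List.mem_cons_self w (List.mem_cons_of_mem _ hw) hp hpw hvw
      rw [List.filter_cons_of_pos (by simpa using hp),
        List.filter_cons_of_neg (by simpa using hp), sampleList, sampleList, h, ih,
        Kernel.comp_assoc]
    · have h : (S ∪ l.toFinset).filter (G.Adj v) =
          (S ∪ (l.filter fun v => ¬ p v).toFinset).filter (G.Adj v) := by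
        ext w
        simp only [mem_filter, mem_union, List.mem_toFinset, List.mem_filter, decide_eq_true_eq]
        refine and_congr_left fun hvw => or_congr_right ⟨fun hw => ⟨hw, ?_⟩, And.left⟩
        exact fun hpw =>
          hadj w (List.mem_cons_of_mem _ hw) v List.mem_cons_self hpw hp hvw.symm
      rw [List.filter_cons_of_neg (by simpa using hp),
        List.filter_cons_of_pos (by simpa using hp), sampleList, sampleList, h, ih,
        ← Kernel.comp_assoc, sampleStep_comp_sampleList, Kernel.comp_assoc]
      · exact hS v List.mem_cons_self
      · exact fun hv => hvl (List.mem_of_mem_filter hv)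
      · intro w hw
        rw [List.mem_filter] at hw
        exact hadj w (List.mem_cons_of_mem _ hw.1) v List.mem_cons_self (by simpa using hw.2) hp
      · intro w hw
        have hwS := hS w (List.mem_cons_of_mem _ (List.mem_of_mem_filter hw))
        rw [List.mem_filter] at hw
        have : p w := by simpa using hw.2
        simp [hwS, this]

theorem lintegral_sampleList_patch {S : Finset V} {l : List V} (hl : l.Nodup) (x : V → J)
    {f : (V → J) → ℝ≥0∞} (hf : Measurable f) :
    ∫⁻ z, f z ∂sampleList G R S l x =
      ∫⁻ z, f (fun v => if v ∈ l then z v else x v) ∂sampleList G R S l x := by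
  induction l generalizing f with
  | nil =>
    simp only [sampleList, Kernel.id_apply, List.not_mem_nil, if_false, lintegral_const,
      measure_univ, mul_one]
    exact lintegral_dirac' _ hf
  | cons v l ih =>
    obtain ⟨hvl, hl⟩ := List.nodup_cons.1 hl
    have hm : Measurable fun z : V → J => fun w => if w ∈ v :: l then z w else x w :=
      measurable_pi_lambda _ fun w => by split_ifs <;> fun_prop
    have hfm := hf.comp hm
    simp only [Function.comp_def] at hfm
    rw [lintegral_sampleList_cons _ _ _ _ hf, lintegral_sampleList_cons _ _ _ _ hfm,
      ih hl hf.lintegral_kernel, ih hl hfm.lintegral_kernel]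
    refine lintegral_congr fun z => ?_
    rw [lintegral_sampleStep _ _ _ hf, lintegral_sampleStep _ _ _ hfm]
    refine lintegral_congr fun t => congrArg f ?_
    ext w
    rcases eq_or_ne w v with rfl | h
    · simp
    · by_cases hw : w ∈ l <;> simp [h, hw]

theorem lintegral_sampleList_mul {S : Finset V} {l : List V} (hl : l.Nodup) (x : V → J)
    {h f : (V → J) → ℝ≥0∞} (hh : Measurable h) (hf : Measurable f)
    (hhl : ∀ y, (∀ v, v ∉ l → x v = y v) → h y = h x) :
    ∫⁻ z, h z * f z ∂sampleList G R S l x = h x * ∫⁻ z, f z ∂sampleList G R S l x := by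
  have hm : Measurable fun z : V → J => fun w => if w ∈ l then z w else x w :=
    measurable_pi_lambda _ fun w => by split_ifs <;> fun_prop
  have hfm := hf.comp hm
  simp only [Function.comp_def] at hfm
  rw [lintegral_sampleList_patch hl x (f := fun z => h z * f z) (hh.mul hf),
    lintegral_sampleList_patch hl x hf,
    ← lintegral_const_mul _ hfm]
  refine lintegral_congr fun z => ?_
  rw [hhl]
  intro v hv; simp [hv]

theorem lintegral_sampleList_congr {S : Finset V} {l : List V} {f : (V → J) → ℝ≥0∞}
    (hf : Measurable f) (hfS : ∀ x y, (∀ v ∈ S ∪ l.toFinset, x v = y v) → f x = f y)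
    {x y : V → J} (hxy : ∀ v ∈ S, x v = y v) :
    ∫⁻ z, f z ∂sampleList G R S l x = ∫⁻ z, f z ∂sampleList G R S l y := by
  induction l generalizing f with
  | nil =>
    simp only [sampleList, Kernel.id_apply, lintegral_dirac' _ hf]
    exact hfS _ _ (by simpa using hxy)
  | cons v l ih =>
    rw [lintegral_sampleList_cons _ _ _ _ hf, lintegral_sampleList_cons _ _ _ _ hf]
    refine ih hf.lintegral_kernel fun z z' hz => ?_
    rw [lintegral_sampleStep _ _ _ hf, lintegral_sampleStep _ _ _ hf]
    have : ∀ A ⊆ S ∪ l.toFinset, A.restrict z = A.restrict z' := fun A hA => by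
      ext ⟨i, hi⟩; exact hz i (hA hi)
    rw [this _ (filter_subset (G.Adj v) _)]
    refine lintegral_congr fun t => hfS _ _ fun w hw => ?_
    rcases eq_or_ne w v with rfl | h
    · simp
    · simp only [Function.update_of_ne h]
      exact hz w (by simpa [h] using hw)

theorem exists_lintegral_sampleList_le_one {S : Finset V} {l : List V} (hl : l.Nodup)
    (hS : ∀ v ∈ l, v ∉ S) :
    ∃ g : (V → J) → ℝ≥0∞, Measurable g ∧ (∀ x, g x ≠ 0) ∧ (∀ x, g x ≠ ∞) ∧
      (∀ x y, (∀ v ∈ S ∪ l.toFinset, x v = y v) → g x = g y) ∧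
      ∀ x, ∫⁻ z, g z ∂sampleList G R S l x ≤ 1 := by
  induction l with
  | nil => exact ⟨fun _ => 1, measurable_const, by simp, by simp, by simp, by simp [sampleList]⟩
  | cons v l ih =>
    obtain ⟨hvl, hl⟩ := List.nodup_cons.1 hl
    obtain ⟨g, hg, hg0, hg1, hgS, hgi⟩ := ih hl fun w hw => hS w (List.mem_cons_of_mem _ hw)
    set A := (S ∪ l.toFinset).filter (G.Adj v) with hA
    have hAS : A ⊆ S ∪ l.toFinset := filter_subset _ _
    have hvS : v ∉ S ∪ l.toFinset := by
      simpa [hvl] using hS v List.mem_cons_self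
    have hm : Measurable fun x : V → J => 1 + R A (A.restrict x) Set.univ :=
      (((R A).measurable_coe MeasurableSet.univ).comp (Finset.measurable_restrict A)).const_add 1
    have hm0 : ∀ x : V → J, 1 + R A (A.restrict x) Set.univ ≠ 0 := by simp
    have hm1 : ∀ x : V → J, 1 + R A (A.restrict x) Set.univ ≠ ∞ := by simp
    have hr : ∀ {x y : V → J}, (∀ v ∈ S ∪ l.toFinset, x v = y v) →
        A.restrict x = A.restrict y := fun {x y} h => by
      ext ⟨i, hi⟩; exact h i (hAS hi)
    have hinv : ∀ (x : V → J) t, ∀ w ∈ S ∪ l.toFinset, Function.update x v t w = x w :=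
      fun x t w hw => Function.update_of_ne (ne_of_mem_of_not_mem hw hvS) _ _
    have hgm : Measurable fun x => g x / (1 + R A (A.restrict x) Set.univ) := hg.div hm
    refine ⟨fun x => g x / (1 + R A (A.restrict x) Set.univ), hgm,
      fun x => ENNReal.div_ne_zero.2 ⟨hg0 x, hm1 x⟩, fun x => ENNReal.div_ne_top (hg1 x) (hm0 x),
      fun x y hxy => ?_, fun x => ?_⟩
    · have h : ∀ w ∈ S ∪ l.toFinset, x w = y w := fun w hw => hxy w (by
        simp only [mem_union, List.mem_toFinset, List.mem_cons] at hw ⊢; tauto)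
      simp only [hgS x y h, hr h]
    · rw [lintegral_sampleList_cons _ _ _ _ hgm]
      refine (lintegral_mono fun z => ?_).trans (hgi x)
      rw [← hA, lintegral_sampleStep _ _ _ hgm]
      simp only [hgS _ _ (hinv z _), hr (hinv z _), lintegral_const]
      rw [← ENNReal.mul_div_right_comm]
      exact ENNReal.div_le_of_le_mul (by gcongr; exact le_add_self)

end sampling

section order

variable {G : SimpleGraph V} [DecidableRel G.Adj] {R : (A : Finset V) → Kernel (↥A → J) J}
  [hR : ∀ A x, IsFiniteMeasure (R A x)]

theorem lintegral_bind_sampleStep (m : Measure (V → J)) (v : V) (A : Finset V)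
    {f : (V → J) → ℝ≥0∞} (hf : Measurable f) :
    ∫⁻ x, f x ∂m.bind (sampleStep R v A) =
      ∫⁻ x, ∫⁻ t, f (Function.update x v t) ∂(R A (A.restrict x)) ∂m := by
  rw [Measure.lintegral_bind (Kernel.aemeasurable _) hf.aemeasurable]
  simp_rw [lintegral_sampleStep _ _ _ hf]

theorem measurable_lintegral_update (v : V) (A : Finset V)
    {f : (V → J) → ℝ≥0∞} (hf : Measurable f) :
    Measurable fun x => ∫⁻ t, f (Function.update x v t) ∂(R A (A.restrict x)) := by
  simp_rw [← lintegral_sampleStep v A _ hf]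
  exact hf.lintegral_kernel

theorem measurable_lmarginal_restrict (C D : Finset V) {f : (V → J) → ℝ≥0∞} (hf : Measurable f) :
    Measurable fun x => lmarginal (fun _ => R D (D.restrict x)) C f x := by
  have : IsSFiniteKernel (R D) := isSFiniteKernel_of_forall_isFiniteMeasure _ (hR D)
  have hm : Measurable fun p : (V → J) × (↥C → J) => f (Function.updateFinset p.1 C p.2) :=
    hf.comp (measurable_pi_lambda _ fun v => by
      unfold Function.updateFinset; split_ifs <;> fun_prop)
  exact hm.lintegral_kernel_prod_right' (κ := (piKernel ↥C (R D) (hR D)).comap D.restrict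
    (Finset.measurable_restrict D))

theorem lintegral_bind_sampleStep_eq_lmarginal {m m₀ : Measure (V → J)} {C D : Finset V} {c : V}
    (hcC : c ∉ C) (hCD : Disjoint C D)
    (hm : ∀ f : (V → J) → ℝ≥0∞, Measurable f →
      ∫⁻ x, f x ∂m = ∫⁻ x, lmarginal (fun _ => R D (D.restrict x)) C f x ∂m₀)
    {f : (V → J) → ℝ≥0∞} (hf : Measurable f) :
    ∫⁻ x, f x ∂m.bind (sampleStep R c D) =
      ∫⁻ x, lmarginal (fun _ => R D (D.restrict x)) (insert c C) f x ∂m₀ := by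
  rw [lintegral_bind_sampleStep _ _ _ hf, hm _ (measurable_lintegral_update c D hf)]
  refine lintegral_congr fun x => ?_
  rw [lmarginal_insert' _ hf hcC]
  refine lintegral_congr fun y => ?_
  have : D.restrict (Function.updateFinset x C y) = D.restrict x := by
    ext ⟨i, hi⟩
    simp [Function.updateFinset, Finset.disjoint_right.1 hCD hi]
  simp only [this]

theorem lintegral_eq_lmarginal_of_recursion {m : Finset V → Measure (V → J)} {C D : Finset V}
    (hCD : Disjoint C D)
    (hm : ∀ C' ⊆ C, ∀ c ∈ C', m (C' ∪ D) = (m (C'.erase c ∪ D)).bind (sampleStep R c D))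
    {f : (V → J) → ℝ≥0∞} (hf : Measurable f) :
    ∫⁻ x, f x ∂m (C ∪ D) = ∫⁻ x, lmarginal (fun _ => R D (D.restrict x)) C f x ∂m D := by
  induction C using Finset.induction_on generalizing f with
  | empty => simp
  | insert c C hc ih =>
    rw [hm _ subset_rfl c (mem_insert_self _ _), erase_insert hc]
    have hCD' := hCD.mono_left (subset_insert c C)
    exact lintegral_bind_sampleStep_eq_lmarginal hc hCD'
      (fun f hf => ih hCD' (fun C' hC' => hm C' (hC'.trans (subset_insert _ _))) hf) hf

/-- The recursion satisfied by the sampling measures at the set `S`: they may be obtained by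
sampling `u` last, for any `u ∈ S`. -/
def SampleRecursion (G : SimpleGraph V) [DecidableRel G.Adj]
    (R : (A : Finset V) → Kernel (↥A → J) J)
    (m : Finset V → Measure (V → J)) (S : Finset V) : Prop :=
  ∀ u ∈ S, m S = (m (S.erase u)).bind (sampleStep R u (S.filter (G.Adj u)))

theorem bind_sampleStep_eq_of_not_adj {m : Finset V → Measure (V → J)} {S : Finset V} {u w : V}
    (hu : u ∈ S) (hw : w ∈ S) (huw : ¬ G.Adj u w)
    (hm : ∀ T ⊂ S, SampleRecursion G R m T) :
    (m (S.erase u)).bind (sampleStep R u (S.filter (G.Adj u))) =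
      (m (S.erase w)).bind (sampleStep R w (S.filter (G.Adj w))) := by
  rcases eq_or_ne u w with rfl | hne
  · rfl
  have hwu : ¬ G.Adj w u := fun h => huw h.symm
  have h1 : (S.erase u).filter (G.Adj w) = S.filter (G.Adj w) := by
    rw [filter_erase, erase_eq_of_notMem (by simp [hwu])]
  have h2 : (S.erase w).filter (G.Adj u) = S.filter (G.Adj u) := by
    rw [filter_erase, erase_eq_of_notMem (by simp [huw])]
  rw [hm _ (erase_ssubset hu) w (mem_erase.2 ⟨hne.symm, hw⟩),
    hm _ (erase_ssubset hw) u (mem_erase.2 ⟨hne, hu⟩), h1, h2, erase_right_comm,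
    Measure.comp_assoc, Measure.comp_assoc, sampleStep_comm hne (by simp [huw]) (by simp [hwu])]

theorem lintegral_bind_sampleStep_of_complete {π : Measure J} [IsFiniteMeasure π] {x₀ : V → J}
    {m : Finset V → Measure (V → J)} (hm0 : m ∅ = Measure.dirac x₀) (hR0 : ∀ x, R ∅ x = π)
    {A B : Finset V} (hAB : Disjoint A B) (hA : ∀ u ∈ A, ∀ w ∈ A, ¬ G.Adj u w)
    (hB : ∀ u ∈ B, ∀ w ∈ B, ¬ G.Adj u w) (hadj : ∀ u ∈ A, ∀ w ∈ B, G.Adj u w)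
    (hm : ∀ T ⊂ A ∪ B, SampleRecursion G R m T) {u : V} (hu : u ∈ A)
    {f : (V → J) → ℝ≥0∞} (hf : Measurable f) :
    ∫⁻ x, f x ∂(m ((A ∪ B).erase u)).bind (sampleStep R u ((A ∪ B).filter (G.Adj u))) =
      ∫⁻ y : ↥B → J, ∫⁻ z : ↥A → J,
        f (Function.updateFinset (Function.updateFinset x₀ B y) A z)
          ∂(Measure.pi fun _ => R B y) ∂(Measure.pi fun _ => π) := by
  have huB : u ∉ B := Finset.disjoint_left.1 hAB hu
  have h1 : ∀ C ⊆ A, ∀ c ∈ C, (C ∪ B).filter (G.Adj c) = B := by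
    intro C hC c hc
    ext w
    simp only [mem_filter, mem_union]
    exact ⟨fun h => h.1.resolve_left fun hw => hA c (hC hc) w (hC hw) h.2,
      fun h => ⟨Or.inr h, hadj c (hC hc) w h⟩⟩
  have h2 : (A ∪ B).erase u = A.erase u ∪ B := by
    rw [erase_union_distrib, erase_eq_of_notMem huB]
  have hsub : ∀ T ⊆ A.erase u ∪ B, T ⊂ A ∪ B := fun T hT =>
    hT.trans_ssubset (h2 ▸ erase_ssubset (mem_union_left _ hu))
  have hdis : Disjoint (A.erase u) B := hAB.mono_left (erase_subset _ _)
  have hmA : ∀ f : (V → J) → ℝ≥0∞, Measurable f → ∫⁻ x, f x ∂m (A.erase u ∪ B) =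
      ∫⁻ x, lmarginal (fun _ => R B (B.restrict x)) (A.erase u) f x ∂m B := fun f hf =>
    lintegral_eq_lmarginal_of_recursion hdis (fun C hC c hc => by
      have hCA := hC.trans (erase_subset u A)
      rw [hm _ (hsub _ (union_subset_union_left hC)) c (mem_union_left _ hc), h1 C hCA c hc,
        erase_union_distrib, erase_eq_of_notMem (Finset.disjoint_left.1 hAB (hCA hc))]) hf
  have hmB : ∀ f : (V → J) → ℝ≥0∞, Measurable f → ∫⁻ x, f x ∂m (B ∪ ∅) =
      ∫⁻ x, lmarginal (fun _ => R ∅ (Finset.restrict ∅ x)) B f x ∂m ∅ := fun f hf =>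
    lintegral_eq_lmarginal_of_recursion (disjoint_empty_right _) (fun C hC c hc => by
      rw [union_empty, union_empty, hm C (hsub _ (hC.trans subset_union_right)) c hc,
        filter_eq_empty_iff.2 fun w hw => hB c (hC hc) w (hC hw)]) hf
  rw [union_empty] at hmB
  rw [h1 A subset_rfl u hu, h2, lintegral_bind_sampleStep_eq_lmarginal (notMem_erase u A) hdis
    hmA hf, insert_erase hu, hmB _ (measurable_lmarginal_restrict _ _ hf), hm0,
    lintegral_dirac' _ (measurable_lmarginal_restrict _ _ (measurable_lmarginal_restrict _ _ hf))]
  simp only [lmarginal, hR0]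
  refine lintegral_congr fun y => ?_
  rw [Function.restrict_updateFinset]

end order

section sampleMeasure

variable {G : SimpleGraph V} [DecidableRel G.Adj] {R : (A : Finset V) → Kernel (↥A → J) J}
  [hR : ∀ A x, IsFiniteMeasure (R A x)] {π : Measure J} [IsFiniteMeasure π] {x₀ : V → J}

/-- Sampling `J^A` from `π` and then `J^B` from the powers of `R A` gives the same measure as with
the roles of `A` and `B` exchanged, for complete bipartite subgraphs with sides `A` and `B`. -/
def SymmOnBipartite (G : SimpleGraph V) (R : (A : Finset V) → Kernel (↥A → J) J)
    (π : Measure J) : Prop :=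
  ∀ A B : Finset V, A.Nonempty → B.Nonempty → Disjoint A B → (∀ u ∈ A, ∀ w ∈ B, G.Adj u w) →
    ∀ f : (↥A → J) × (↥B → J) → ℝ≥0∞, Measurable f →
      ∫⁻ x, ∫⁻ y, f (x, y) ∂(Measure.pi fun _ => R A x) ∂(Measure.pi fun _ => π) =
        ∫⁻ y, ∫⁻ x, f (x, y) ∂(Measure.pi fun _ => R B y) ∂(Measure.pi fun _ => π)

theorem bind_sampleStep_eq_of_complete {m : Finset V → Measure (V → J)}
    (hm0 : m ∅ = Measure.dirac x₀) (hR0 : ∀ x, R ∅ x = π) (hs : SymmOnBipartite G R π)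
    {A B : Finset V} (hA : ∀ u ∈ A, ∀ w ∈ A, ¬ G.Adj u w)
    (hB : ∀ u ∈ B, ∀ w ∈ B, ¬ G.Adj u w) (hadj : ∀ u ∈ A, ∀ w ∈ B, G.Adj u w)
    (hm : ∀ T ⊂ A ∪ B, SampleRecursion G R m T) {u w : V} (hu : u ∈ A) (hw : w ∈ B) :
    (m ((A ∪ B).erase u)).bind (sampleStep R u ((A ∪ B).filter (G.Adj u))) =
      (m ((A ∪ B).erase w)).bind (sampleStep R w ((A ∪ B).filter (G.Adj w))) := by
  have hAB : Disjoint A B :=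
    Finset.disjoint_left.2 fun v hvA hvB => hA v hvA v hvA (hadj v hvA v hvB)
  refine Measure.ext_of_lintegral _ fun f hf => ?_
  rw [lintegral_bind_sampleStep_of_complete hm0 hR0 hAB hA hB hadj hm hu hf, union_comm A B,
    lintegral_bind_sampleStep_of_complete hm0 hR0 hAB.symm hB hA
      (fun u hu w hw => (hadj w hw u hu).symm) (union_comm A B ▸ hm) hw hf]
  have hfm : Measurable fun p : (↥A → J) × (↥B → J) =>
      f (Function.updateFinset (Function.updateFinset x₀ B p.2) A p.1) :=
    hf.comp (measurable_pi_lambda _ fun v => by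
      unfold Function.updateFinset; split_ifs <;> fun_prop)
  have hcomm : ∀ (z : ↥A → J) (y : ↥B → J),
      Function.updateFinset (Function.updateFinset x₀ B y) A z =
      Function.updateFinset (Function.updateFinset x₀ A z) B y := by
    intro z y
    ext v
    by_cases h1 : v ∈ A
    · simp [Function.updateFinset, h1, Finset.disjoint_left.1 hAB h1]
    · simp [Function.updateFinset, h1]
  simp_rw [← hcomm]
  exact (hs A B ⟨u, hu⟩ ⟨w, hw⟩ hAB hadj _ hfm).symm

theorem bind_sampleStep_eq {m : Finset V → Measure (V → J)} (hG : G.CliqueFree 3)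
    (hm0 : m ∅ = Measure.dirac x₀) (hR0 : ∀ x, R ∅ x = π) (hs : SymmOnBipartite G R π)
    {S : Finset V} (hm : ∀ T ⊂ S, SampleRecursion G R m T) {u w : V} (hu : u ∈ S) (hw : w ∈ S) :
    (m (S.erase u)).bind (sampleStep R u (S.filter (G.Adj u))) =
      (m (S.erase w)).bind (sampleStep R w (S.filter (G.Adj w))) := by
  by_cases huw : G.Adj u w
  swap
  · exact bind_sampleStep_eq_of_not_adj hu hw huw hm
  have htri : ∀ a b c, G.Adj a b → G.Adj a c → ¬ G.Adj b c := fun a b c hab hac hbc =>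
    hG {a, b, c} (SimpleGraph.is3Clique_triple_iff.2 ⟨hab, hac, hbc⟩)
  by_cases hz : ∃ z ∈ S, ¬ G.Adj u z ∧ ¬ G.Adj z w
  · obtain ⟨z, hzS, h1, h2⟩ := hz
    rw [bind_sampleStep_eq_of_not_adj hu hzS h1 hm, bind_sampleStep_eq_of_not_adj hzS hw h2 hm]
  push Not at hz
  set A := S.filter (G.Adj w) with hA
  set B := S.filter (G.Adj u) with hB
  have hS : S = A ∪ B := by
    ext z
    simp only [hA, hB, mem_union, mem_filter]
    refine ⟨fun h => ?_, by tauto⟩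
    by_cases h1 : G.Adj u z
    · exact Or.inr ⟨h, h1⟩
    · exact Or.inl ⟨h, (hz z h h1).symm⟩
  have hAi : ∀ a ∈ A, ∀ b ∈ A, ¬ G.Adj a b := fun a ha b hb =>
    htri w a b (mem_filter.1 ha).2 (mem_filter.1 hb).2
  have hBi : ∀ a ∈ B, ∀ b ∈ B, ¬ G.Adj a b := fun a ha b hb =>
    htri u a b (mem_filter.1 ha).2 (mem_filter.1 hb).2
  have huA : u ∈ A := mem_filter.2 ⟨hu, huw.symm⟩
  have hwB : w ∈ B := mem_filter.2 ⟨hw, huw⟩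
  by_cases hab : ∀ a ∈ A, ∀ b ∈ B, G.Adj a b
  · have := bind_sampleStep_eq_of_complete hm0 hR0 hs hAi hBi hab (hS ▸ hm) huA hwB
    rwa [← hS] at this
  · push Not at hab
    obtain ⟨a, ha, b, hb, hab⟩ := hab
    have haS := (mem_filter.1 ha).1
    have hbS := (mem_filter.1 hb).1
    rw [bind_sampleStep_eq_of_not_adj hu haS (hAi u huA a ha) hm,
      bind_sampleStep_eq_of_not_adj haS hbS hab hm,
      bind_sampleStep_eq_of_not_adj hbS hw (hBi b hb w hwB) hm]

variable [Fintype V]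

/-- The law on `J^V` obtained by sampling the vertices of `S` one after another, each given its
previously sampled neighbours, and keeping the coordinates of `x₀` outside `S`. -/
noncomputable def sampleMeasure (G : SimpleGraph V) [DecidableRel G.Adj]
    (R : (A : Finset V) → Kernel (↥A → J) J) (x₀ : V → J) (S : Finset V) : Measure (V → J) :=
  sampleList G R ∅ (univ.toList.filter (· ∈ S)) x₀

theorem sampleMeasure_empty : sampleMeasure G R x₀ ∅ = Measure.dirac x₀ := by
  simp [sampleMeasure, sampleList, Kernel.id_apply]

theorem exists_sampleMeasure_eq_bind {S : Finset V} (hS : S.Nonempty) :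
    ∃ u ∈ S, sampleMeasure G R x₀ S =
      (sampleMeasure G R x₀ (S.erase u)).bind (sampleStep R u (S.filter (G.Adj u))) := by
  have hmem : ∀ v, v ∈ univ.toList.filter (· ∈ S) ↔ v ∈ S := by simp
  have hnd : (univ.toList.filter (· ∈ S)).Nodup := (nodup_toList _).filter _
  rcases h : (univ.toList.filter (· ∈ S)) with _ | ⟨u, l⟩
  · obtain ⟨v, hv⟩ := hS
    simpa [h] using (hmem v).2 hv
  rw [h] at hmem hnd
  obtain ⟨hul, hnd⟩ := List.nodup_cons.1 hnd
  have huS := (hmem u).1 List.mem_cons_self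
  have hl : univ.toList.filter (· ∈ S.erase u) = l := by
    have : univ.toList.filter (· ∈ S.erase u) =
        (univ.toList.filter (· ∈ S)).filter (· ≠ u) := by
      rw [List.filter_filter]
      congr 1
      ext v
      simp
    rw [this, h, List.filter_cons_of_neg (by simp), List.filter_eq_self]
    intro v hv
    simpa using ne_of_mem_of_not_mem hv hul
  refine ⟨u, huS, ?_⟩
  have hlS : (∅ ∪ l.toFinset).filter (G.Adj u) = S.filter (G.Adj u) := by
    ext v
    simp only [empty_union, mem_filter, List.mem_toFinset]
    refine and_congr_left fun hv => ?_
    rw [← hmem v, List.mem_cons, or_iff_right hv.ne']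
  rw [sampleMeasure, sampleMeasure, h, hl, sampleList, hlS]
  exact Kernel.comp_apply _ _ _

theorem sampleRecursion_sampleMeasure (hG : G.CliqueFree 3) (hR0 : ∀ x, R ∅ x = π)
    (hs : SymmOnBipartite G R π) (S : Finset V) :
    SampleRecursion G R (sampleMeasure G R x₀) S := by
  induction S using Finset.strongInduction with
  | H S ih =>
    intro w hw
    obtain ⟨u, hu, h⟩ := exists_sampleMeasure_eq_bind (G := G) (R := R) (x₀ := x₀) ⟨w, hw⟩
    rw [h, bind_sampleStep_eq hG sampleMeasure_empty hR0 hs ih hu hw]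

theorem lintegral_sampleMeasure_union
    (hm : ∀ S, SampleRecursion G R (sampleMeasure G R x₀) S) {S : Finset V} {l : List V}
    (hl : l.Nodup) (hS : ∀ v ∈ l, v ∉ S) {f : (V → J) → ℝ≥0∞} (hf : Measurable f) :
    ∫⁻ x, f x ∂sampleMeasure G R x₀ (S ∪ l.toFinset) =
      ∫⁻ x, ∫⁻ z, f z ∂sampleList G R S l x ∂sampleMeasure G R x₀ S := by
  induction l generalizing f with
  | nil => simp [sampleList, lintegral_dirac' _ hf, Kernel.id_apply]
  | cons v l ih =>
    obtain ⟨hvl, hl⟩ := List.nodup_cons.1 hl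
    have hvS := hS v List.mem_cons_self
    have h1 : (S ∪ (v :: l).toFinset).erase v = S ∪ l.toFinset := by
      ext w
      simp only [mem_erase, mem_union, List.mem_toFinset, List.mem_cons]
      constructor
      · tauto
      · rintro (h | h)
        · exact ⟨ne_of_mem_of_not_mem h hvS, Or.inl h⟩
        · exact ⟨ne_of_mem_of_not_mem h hvl, Or.inr (Or.inr h)⟩
    have h2 : (S ∪ (v :: l).toFinset).filter (G.Adj v) = (S ∪ l.toFinset).filter (G.Adj v) := by
      rw [← h1, filter_erase, erase_eq_of_notMem (by simp)]
    rw [hm _ v (by simp), h1, h2, Measure.lintegral_bind (Kernel.aemeasurable _) hf.aemeasurable,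
      ih hl (fun w hw => hS w (List.mem_cons_of_mem _ hw)) hf.lintegral_kernel]
    simp_rw [lintegral_sampleList_cons _ _ _ _ hf]

end sampleMeasure

theorem sigmaFinite_of_lintegral_le_one {α : Type*} [MeasurableSpace α] {m : Measure α}
    {g : α → ℝ≥0∞} (hg : Measurable g) (h0 : ∀ x, g x ≠ 0) (ht : ∀ x, g x ≠ ∞)
    (h : ∫⁻ x, g x ∂m ≤ 1) : SigmaFinite m := by
  have := isFiniteMeasure_withDensity (ne_top_of_le_ne_top ENNReal.one_ne_top h)
  rw [← withDensity_inv_same hg (ae_of_all m h0) (ae_of_all m ht)]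
  exact SigmaFinite.withDensity_of_ne_top' fun x => ENNReal.inv_ne_top.2 (h0 x)

section marginals

variable [Fintype V] {G : SimpleGraph V} [DecidableRel G.Adj]
  {R : (A : Finset V) → Kernel (↥A → J) J} [hR : ∀ A x, IsFiniteMeasure (R A x)] {x₀ : V → J}

/-- Marginal on `J^S` of the sampling measure at `S`. -/
noncomputable def sampleMarginal (G : SimpleGraph V) [DecidableRel G.Adj]
    (R : (A : Finset V) → Kernel (↥A → J) J) (x₀ : V → J) (S : Finset V) : Measure (↥S → J) :=
  (sampleMeasure G R x₀ S).map S.restrict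

theorem measurable_updateFinset_base (x₀ : V → J) (S : Finset V) :
    Measurable fun y : ↥S → J => Function.updateFinset x₀ S y :=
  measurable_pi_lambda _ fun v => by unfold Function.updateFinset; split_ifs <;> fun_prop

/-- The law of the coordinates in `D` sampled after those in `S` are given. -/
noncomputable def sampleKernel (G : SimpleGraph V) [DecidableRel G.Adj]
    (R : (A : Finset V) → Kernel (↥A → J) J) (x₀ : V → J) (S D : Finset V) :
    Kernel (↥S → J) (↥D → J) :=
  ((sampleList G R S (univ.toList.filter (· ∈ D))).comap _
    (measurable_updateFinset_base x₀ S)).map D.restrict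

theorem lintegral_sampleKernel {S D : Finset V} {x : ↥S → J} {f : (↥D → J) → ℝ≥0∞}
    (hf : Measurable f) :
    ∫⁻ y, f y ∂sampleKernel G R x₀ S D x =
      ∫⁻ z, f (D.restrict z) ∂sampleList G R S (univ.toList.filter (· ∈ D))
        (Function.updateFinset x₀ S x) := by
  rw [sampleKernel, Kernel.map_apply _ (Finset.measurable_restrict D),
    lintegral_map hf (Finset.measurable_restrict D), Kernel.comap_apply]

theorem nodup_filter_toList (D : Finset V) : (univ.toList.filter (· ∈ D)).Nodup :=
  (nodup_toList _).filter _

theorem mem_filter_toList {D : Finset V} {v : V} : v ∈ univ.toList.filter (· ∈ D) ↔ v ∈ D := by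
  simp

theorem toFinset_filter_toList (D : Finset V) : (univ.toList.filter (· ∈ D)).toFinset = D := by
  ext v; simp

theorem sigmaFinite_sampleMarginal (S : Finset V) : SigmaFinite (sampleMarginal G R x₀ S) := by
  obtain ⟨g, hg, h0, ht, hS, hi⟩ := exists_lintegral_sampleList_le_one (G := G) (R := R)
    (S := ∅) (nodup_filter_toList S) (by simp)
  rw [toFinset_filter_toList, empty_union] at hS
  have hgm := hg.comp (measurable_updateFinset_base x₀ S)
  refine sigmaFinite_of_lintegral_le_one hgm (fun x => h0 _) (fun x => ht _) ?_
  rw [sampleMarginal, lintegral_map hgm (Finset.measurable_restrict S)]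
  refine (lintegral_congr fun z => hS _ z fun v hv => ?_).trans_le (hi x₀)
  simp [Function.updateFinset, hv]

theorem sigmaFinite_sampleKernel {S D : Finset V} (hSD : Disjoint S D) (x : ↥S → J) :
    SigmaFinite (sampleKernel G R x₀ S D x) := by
  obtain ⟨g, hg, h0, ht, hS, hi⟩ := exists_lintegral_sampleList_le_one (G := G) (R := R)
    (S := S) (nodup_filter_toList D)
    (fun v hv => Finset.disjoint_right.1 hSD (mem_filter_toList.1 hv))
  have hgm := hg.comp (measurable_updateFinset_base (Function.updateFinset x₀ S x) D)
  refine sigmaFinite_of_lintegral_le_one hgm (fun x => h0 _) (fun x => ht _) ?_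
  rw [lintegral_sampleKernel hgm]
  refine le_of_eq_of_le ?_ (hi (Function.updateFinset x₀ S x))
  rw [lintegral_sampleList_patch (nodup_filter_toList D) _ hg]
  refine lintegral_congr fun z => congrArg g ?_
  ext v
  by_cases hv : v ∈ D <;> simp [Function.updateFinset, hv]

theorem sampleMarginal_apply_and
    (hm : ∀ S, SampleRecursion G R (sampleMeasure G R x₀) S) {S T : Finset V} (h : S ⊆ T)
    {A : Set (↥S → J)} {B : Set (↥(T \ S) → J)} (hA : MeasurableSet A) (hB : MeasurableSet B) :
    sampleMarginal G R x₀ T {x | restr S T h x ∈ A ∧ restr (T \ S) T sdiff_subset x ∈ B} =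
      ∫⁻ x in A, sampleKernel G R x₀ S (T \ S) x B ∂sampleMarginal G R x₀ S := by
  set l := univ.toList.filter (· ∈ T \ S) with hl
  have hlS : ∀ v ∈ l, v ∉ S := fun v hv => (mem_sdiff.1 (mem_filter_toList.1 hv)).2
  have hT : T = S ∪ l.toFinset := by
    rw [toFinset_filter_toList, union_sdiff_of_subset h]
  let fA : (V → J) → ℝ≥0∞ := fun z => A.indicator 1 (S.restrict z)
  let fB : (V → J) → ℝ≥0∞ := fun z => B.indicator 1 ((T \ S).restrict z)
  have hBm : Measurable (B.indicator (1 : (↥(T \ S) → J) → ℝ≥0∞)) := measurable_one.indicator hB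
  have hfA : Measurable fA := (measurable_one.indicator hA).comp (Finset.measurable_restrict S)
  have hfB : Measurable fB := hBm.comp (Finset.measurable_restrict _)
  have hset : MeasurableSet {x | restr S T h x ∈ A ∧ restr (T \ S) T sdiff_subset x ∈ B} :=
    (measurable_restr h hA).inter (measurable_restr sdiff_subset hB)
  have h1 : sampleMarginal G R x₀ T {x | restr S T h x ∈ A ∧ restr (T \ S) T sdiff_subset x ∈ B} =
      ∫⁻ z, fA z * fB z ∂sampleMeasure G R x₀ T := by
    rw [sampleMarginal, Measure.map_apply (Finset.measurable_restrict T) hset,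
      ← lintegral_indicator_one (Finset.measurable_restrict T hset)]
    refine lintegral_congr fun z => ?_
    change ((fun z : V → J => (S.restrict z : ↥S → J)) ⁻¹' A ∩
      (fun z : V → J => ((T \ S).restrict z : ↥(T \ S) → J)) ⁻¹' B).indicator 1 z = _
    rw [Set.inter_indicator_one]
    rfl
  have h2 : ∀ x, ∫⁻ z, fA z * fB z ∂sampleList G R S l x =
      fA x * sampleKernel G R x₀ S (T \ S) (S.restrict x) B := fun x => by
    rw [lintegral_sampleList_mul (nodup_filter_toList _) x hfA hfB fun y hy => ?_,
      ← lintegral_indicator_one hB, lintegral_sampleKernel hBm]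
    · congr 1
      refine lintegral_sampleList_congr hfB (fun y z hyz => ?_) fun v hv => ?_
      · have : (T \ S).restrict y = (T \ S).restrict z := by
          ext ⟨i, hi⟩
          exact hyz i (mem_union_right _ (List.mem_toFinset.2 (mem_filter_toList.2 hi)))
        simp only [fB, this]
      · simp [Function.updateFinset, hv]
    · have : S.restrict y = S.restrict x := by
        ext ⟨i, hi⟩
        exact (hy i fun hil => hlS i hil hi).symm
      simp only [fA, this]
  have hk := (sampleKernel G R x₀ S (T \ S)).measurable_coe hB
  have hunion := lintegral_sampleMeasure_union hm (l := l) (nodup_filter_toList _) hlS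
    (f := fun z => fA z * fB z) (hfA.mul hfB)
  rw [← hT] at hunion
  rw [h1, hunion]
  simp only [h2]
  rw [← lintegral_indicator hA, sampleMarginal,
    lintegral_map (hk.indicator hA) (Finset.measurable_restrict S)]
  refine lintegral_congr fun x => ?_
  by_cases hx : S.restrict x ∈ A <;> simp [fA, hx]

theorem sampleKernel_map_restr {S U W T : Finset V} (hS : U ∩ W = S) (hT : U ∪ W = T)
    (hU : U \ S ⊆ T \ S) (hW : W \ S ⊆ T \ S)
    (hadj : ∀ u ∈ U \ S, ∀ w ∈ W \ S, ¬ G.Adj u w) (x : ↥S → J) :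
    (sampleKernel G R x₀ S (T \ S) x).map (fun y => (restr (U \ S) (T \ S) hU y,
      restr (W \ S) (T \ S) hW y)) =
    (sampleKernel G R x₀ S (U \ S) x).prod (sampleKernel G R x₀ S (W \ S) x) := by
  have := sigmaFinite_sampleKernel (G := G) (R := R) (x₀ := x₀) (disjoint_sdiff (s := S) (t := U)) x
  have := sigmaFinite_sampleKernel (G := G) (R := R) (x₀ := x₀) (disjoint_sdiff (s := S) (t := W)) x
  refine (Measure.prod_eq fun s t hs ht => ?_).symm
  set x' := Function.updateFinset x₀ S x
  have hsm : Measurable (s.indicator (1 : (↥(U \ S) → J) → ℝ≥0∞)) := measurable_one.indicator hs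
  have htm : Measurable (t.indicator (1 : (↥(W \ S) → J) → ℝ≥0∞)) := measurable_one.indicator ht
  let fs : (V → J) → ℝ≥0∞ := fun z => s.indicator 1 ((U \ S).restrict z)
  let ft : (V → J) → ℝ≥0∞ := fun z => t.indicator 1 ((W \ S).restrict z)
  have hfs : Measurable fs := hsm.comp (Finset.measurable_restrict _)
  have hft : Measurable ft := htm.comp (Finset.measurable_restrict _)
  have hset : MeasurableSet ((fun y => (restr (U \ S) (T \ S) hU y,
      restr (W \ S) (T \ S) hW y)) ⁻¹' s ×ˢ t) :=
    ((measurable_restr hU).prodMk (measurable_restr hW)) (hs.prod ht)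
  rw [Measure.map_apply ((measurable_restr hU).prodMk (measurable_restr hW)) (hs.prod ht),
    ← lintegral_indicator_one hset, ← lintegral_indicator_one hs, ← lintegral_indicator_one ht,
    lintegral_sampleKernel hsm, lintegral_sampleKernel htm,
    lintegral_sampleKernel (measurable_one.indicator hset)]
  set l := univ.toList.filter (· ∈ T \ S) with hl
  have hlU : l.filter (fun v => ¬ v ∈ W \ S) = univ.toList.filter (· ∈ U \ S) := by
    rw [hl, List.filter_filter]
    congr 1
    ext v
    have h1 := congrArg (v ∈ ·) hS
    have h2 := congrArg (v ∈ ·) hT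
    simp only [mem_inter, mem_union, eq_iff_iff] at h1 h2
    simp only [mem_sdiff, ← h1, ← h2, ← Bool.decide_and]
    congr 1
    simp only [eq_iff_iff]
    tauto
  have hlW : l.filter (fun v => v ∈ W \ S) = univ.toList.filter (· ∈ W \ S) := by
    rw [hl, List.filter_filter]
    congr 1
    ext v
    rw [← Bool.decide_and]
    congr 1
    simpa using fun h => hW h
  have hsplit := sampleList_eq_comp_filter (R := R) (G := G) (S := S) (· ∈ W \ S) (l := l)
    (nodup_filter_toList _) (fun v hv => (mem_sdiff.1 (mem_filter_toList.1 hv)).2)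
    fun u hu w hw huW hwW hadj' => by
      refine hadj w ?_ u huW hadj'.symm
      have : w ∈ l.filter (fun v => ¬ v ∈ W \ S) := List.mem_filter.2 ⟨hw, decide_eq_true hwW⟩
      rwa [hlU, mem_filter_toList] at this
  rw [hlU, hlW] at hsplit
  have hprod : ∀ z : V → J, ((fun y => (restr (U \ S) (T \ S) hU y,
      restr (W \ S) (T \ S) hW y)) ⁻¹' s ×ˢ t).indicator (1 : (↥(T \ S) → J) → ℝ≥0∞)
        ((T \ S).restrict z) =
      fs z * ft z := fun z => by
    change ({y | restr (U \ S) (T \ S) hU y ∈ s} ∩ {y | restr (W \ S) (T \ S) hW y ∈ t}).indicator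
      1 _ = _
    rw [Set.inter_indicator_one]
    rfl
  simp_rw [hprod]
  have hdis : ∀ v ∈ univ.toList.filter (· ∈ W \ S), v ∉ U \ S := by
    intro v hv hvU
    rw [mem_filter_toList, mem_sdiff] at hv
    exact hv.2 (hS ▸ mem_inter.2 ⟨(mem_sdiff.1 hvU).1, hv.1⟩)
  have hinner : ∀ z, ∫⁻ y, fs y * ft y ∂sampleList G R S (univ.toList.filter (· ∈ W \ S)) z =
      fs z * ∫⁻ y, ft y ∂sampleList G R S (univ.toList.filter (· ∈ W \ S)) z := fun z => by
    refine lintegral_sampleList_mul (nodup_filter_toList _) z hfs hft fun y hy => ?_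
    have : (U \ S).restrict y = (U \ S).restrict z := by
      ext ⟨i, hi⟩
      exact (hy i fun hil => hdis i hil hi).symm
    simp only [fs, this]
  rw [hsplit, Kernel.lintegral_comp _ _ _ (g := fun z => fs z * ft z) (hfs.mul hft)]
  simp_rw [hinner, mul_comm (fs _)]
  rw [lintegral_sampleList_mul (nodup_filter_toList _) x' hft.lintegral_kernel hfs fun y hy => ?_,
    mul_comm]
  refine lintegral_sampleList_congr hft (fun y z hyz => ?_) fun v hv => (hy v fun h => ?_).symm
  · have : (W \ S).restrict y = (W \ S).restrict z := by
      ext ⟨i, hi⟩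
      exact hyz i (mem_union_right _ (List.mem_toFinset.2 (mem_filter_toList.2 hi)))
    simp only [ft, this]
  · exact (mem_sdiff.1 (mem_filter_toList.1 h)).2 hv

end marginals

section normalized

variable [Fintype V] {G : SimpleGraph V} [DecidableRel G.Adj]
  {R : (A : Finset V) → Kernel (↥A → J) J} [hR : ∀ A x, IsFiniteMeasure (R A x)] {x₀ : V → J}
  {π : Measure J}

theorem lintegral_sampleMeasure_singleton
    (hm : ∀ S, SampleRecursion G R (sampleMeasure G R x₀) S) (hR0 : ∀ x, R ∅ x = π) (v : V)
    {f : (V → J) → ℝ≥0∞} (hf : Measurable f) :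
    ∫⁻ x, f x ∂sampleMeasure G R x₀ {v} = ∫⁻ t, f (Function.update x₀ v t) ∂π := by
  rw [hm {v} v (mem_singleton_self v), erase_singleton, sampleMeasure_empty,
    filter_eq_empty_iff.2 (by simp), lintegral_bind_sampleStep _ _ _ hf,
    lintegral_dirac' _ (measurable_lintegral_update _ _ hf), hR0]

theorem sampleMarginal_singleton
    (hm : ∀ S, SampleRecursion G R (sampleMeasure G R x₀) S) (hR0 : ∀ x, R ∅ x = π) (v : V) :
    sampleMarginal G R x₀ {v} = π.map fun j (_ : ↥({v} : Finset V)) => j := by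
  have hc : Measurable fun (j : J) (_ : ↥({v} : Finset V)) => j := by fun_prop
  refine Measure.ext_of_lintegral _ fun f hf => ?_
  rw [sampleMarginal, lintegral_map hf (Finset.measurable_restrict _),
    lintegral_sampleMeasure_singleton hm hR0 v (f := fun x => f (Finset.restrict {v} x))
      (hf.comp (Finset.measurable_restrict _)), lintegral_map hf hc]
  refine lintegral_congr fun t => congrArg f ?_
  ext ⟨i, hi⟩
  rw [mem_singleton] at hi
  subst hi
  simp

theorem pi_singleton_eq_map [IsFiniteMeasure π] (v : V) :
    (Measure.pi fun _ : ↥({v} : Finset V) => π) = π.map fun j _ => j := by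
  have hc : Measurable fun (j : J) (_ : ↥({v} : Finset V)) => j := by fun_prop
  refine Measure.pi_eq fun s hs => ?_
  rw [Measure.map_apply hc (MeasurableSet.univ_pi hs), Fintype.prod_unique]
  congr 1
  ext j
  simp [Set.mem_pi, Unique.forall_iff]

theorem sampleMarginal_edge {η : Measure (J × J)} [IsFiniteMeasure η]
    (hsym : η.map Prod.swap = η) {P : Kernel J J} [IsFiniteMeasure π]
    (hη : ∀ A B, MeasurableSet A → MeasurableSet B → η (B ×ˢ A) = ∫⁻ x in A, P x B ∂π)
    (hm : ∀ S, SampleRecursion G R (sampleMeasure G R x₀) S) (hR0 : ∀ x, R ∅ x = π) {u v : V}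
    (huv : G.Adj u v) (hstar : IsStarKernel π P (R {v})) :
    sampleMarginal G R x₀ {u, v} =
      η.map fun q (w : ↥({u, v} : Finset V)) => if (w : V) = u then q.1 else q.2 := by
  have hc : Measurable fun (j : J) (_ : ↥({v} : Finset V)) => j := by fun_prop
  have hq : Measurable fun (q : J × J) (w : ↥({u, v} : Finset V)) =>
      if (w : V) = u then q.1 else q.2 :=
    measurable_pi_lambda _ fun w => by split_ifs <;> fun_prop
  have hvu : v ≠ u := huv.ne'
  refine (measure_pi_ext_of_box fun B hB => ?_).symm
  have hbox := measurableSet_box (S := {u, v}) hB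
  have hone : Measurable ((finsetBox {u, v} B).indicator (1 : (↥({u, v} : Finset V) → J) → ℝ≥0∞)) :=
    measurable_one.indicator hbox
  have hone' : Measurable fun x : V → J => (finsetBox {u, v} B).indicator
      (1 : (↥({u, v} : Finset V) → J) → ℝ≥0∞) (Finset.restrict {u, v} x) :=
    hone.comp (Finset.measurable_restrict _)
  have hRB := (R {v}).measurable_coe (hB u)
  have h1 : ({u, v} : Finset V).filter (G.Adj u) = {v} := by
    ext w
    simp only [mem_filter, mem_insert, mem_singleton]
    constructor
    · rintro ⟨rfl | rfl, h⟩
      · exact absurd h G.irrefl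
      · rfl
    · rintro rfl
      exact ⟨Or.inr rfl, huv⟩
  have h2 : ({u, v} : Finset V).erase u = {v} := erase_insert (by simpa using huv.ne)
  have hright : η.map (fun q (w : ↥({u, v} : Finset V)) => if (w : V) = u then q.1 else q.2)
      (finsetBox {u, v} B) = η (B v ×ˢ B u) := by
    rw [Measure.map_apply hq hbox, ← hsym, Measure.map_apply measurable_swap ((hB v).prod (hB u)),
      hsym]
    congr 1
    ext q
    simp only [Set.mem_preimage, mem_box, Set.mem_prod, Prod.fst_swap, Prod.snd_swap]
    constructor
    · intro h
      exact ⟨by simpa [hvu] using h v (by simp), by simpa using h u (by simp)⟩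
    · rintro ⟨h, h'⟩ w hw
      rw [mem_insert, mem_singleton] at hw
      rcases hw with rfl | rfl
      · simpa using h'
      · simpa [hvu] using h
  have hpoint : ∀ s t, (finsetBox {u, v} B).indicator (1 : (↥({u, v} : Finset V) → J) → ℝ≥0∞)
      (Finset.restrict {u, v} (Function.update (Function.update x₀ v s) u t)) =
      (B v).indicator 1 s * (B u).indicator 1 t := by
    intro s t
    have : Finset.restrict {u, v} (Function.update (Function.update x₀ v s) u t) ∈
        finsetBox {u, v} B ↔ s ∈ B v ∧ t ∈ B u := by
      simp only [mem_box, mem_insert, mem_singleton, forall_eq_or_imp, Finset.restrict]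
      simp [hvu, and_comm]
    by_cases hs : s ∈ B v <;> by_cases ht : t ∈ B u <;> simp [Set.indicator, this, hs, ht]
  have hrest : ∀ s : J, Finset.restrict {v} (Function.update x₀ v s) = fun _ => s := by
    intro s
    ext ⟨i, hi⟩
    rw [mem_singleton] at hi
    subst hi
    simp
  have hstar' := hstar.setLIntegral_eq (fun _ => B v) (B u) (fun _ => hB v) (hB u)
  simp only [Fintype.prod_unique] at hstar'
  rw [← hη _ _ (hB u) (hB v), pi_singleton_eq_map,
    setLIntegral_map (MeasurableSet.univ_pi fun _ => hB v) hRB hc] at hstar'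
  have hpre : (fun (j : J) (_ : ↥({v} : Finset V)) => j) ⁻¹' (Set.univ.pi fun _ => B v) = B v := by
    ext j; simp [Set.mem_pi]
  rw [hright, ← hstar', hpre, sampleMarginal, ← lintegral_indicator_one hbox,
    lintegral_map hone (Finset.measurable_restrict _), hm {u, v} u (by simp), h1, h2,
    lintegral_bind_sampleStep _ _ _ hone',
    lintegral_sampleMeasure_singleton hm hR0 v (measurable_lintegral_update _ _ hone'),
    ← lintegral_indicator (hB v)]
  refine lintegral_congr fun s => ?_
  simp_rw [hpoint, hrest]
  rw [lintegral_const_mul _ (measurable_one.indicator (hB u)), lintegral_indicator_one (hB u)]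
  by_cases hs : s ∈ B v <;> simp [hs]

theorem isHomMeasureFamily_sampleMarginal {η : Measure (J × J)} [IsProbabilityMeasure η]
    (hsym : η.map Prod.swap = η) {P : Kernel J J}
    (hη : ∀ A B, MeasurableSet A → MeasurableSet B →
      η (B ×ˢ A) = ∫⁻ x in A, P x B ∂(η.map Prod.fst))
    (hm : ∀ S, SampleRecursion G R (sampleMeasure G R x₀) S)
    (hR0 : ∀ x, R ∅ x = η.map Prod.fst)
    (hstar : ∀ u v, G.Adj u v → IsStarKernel (η.map Prod.fst) P (R {v})) :
    IsHomMeasureFamily G η (sampleMarginal G R x₀) := by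
  refine ⟨sigmaFinite_sampleMarginal, sampleMarginal_singleton hm hR0,
    fun u v huv => sampleMarginal_edge hsym hη hm hR0 huv (hstar u v huv), fun S T h => ?_,
    fun S T _ => sampleKernel G R x₀ S (T \ S),
    fun S T h A B hA hB => sampleMarginal_apply_and hm h hA hB, fun U W hadj =>
    Filter.Eventually.of_forall fun x => sampleKernel_map_restr rfl rfl _ _ hadj x⟩
  refine Measure.AbsolutelyContinuous.mk fun N hN hN0 => ?_
  have := sampleMarginal_apply_and hm h hN MeasurableSet.univ
  rw [Measure.restrict_eq_zero.2 hN0, lintegral_zero_measure] at this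
  rw [Measure.map_apply (measurable_restr h) hN]
  simp only [Set.mem_univ, and_true] at this
  exact this

end normalized

/-- **Theorem (triangle-free graphs are well-measured).**
Let `G` be a finite triangle-free simple graph and `(J, η)` a (symmetric) Markov space such
that every complete bipartite subgraph `K_{a,b}` of `G` (`a, b ≥ 1`) is well-measured in `η`.
Then `G` is well-measured in `η`. -/
theorem wellMeasured_of_triangleFree {V J : Type*} [Fintype V] [DecidableEq V]
    [MeasurableSpace J] [StandardBorelSpace J]
    (G : SimpleGraph V) (hG : G.CliqueFree 3)
    (η : Measure (J × J)) [IsProbabilityMeasure η]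
    (hsym : η.map Prod.swap = η)
    (hbip : ∀ a b : ℕ, 1 ≤ a → 1 ≤ b →
      (∃ A B : Finset V, Disjoint A B ∧ A.card = a ∧ B.card = b ∧
        ∀ u ∈ A, ∀ v ∈ B, G.Adj u v) →
      WellMeasured (completeBipartiteGraph (Fin a) (Fin b)) η) :
    WellMeasured G η := by
  classical
  obtain ⟨⟨j, _⟩⟩ := nonempty_of_isProbabilityMeasure η
  have : Nonempty J := ⟨j⟩
  have : IsProbabilityMeasure (η.map Prod.fst) :=
    Measure.isProbabilityMeasure_map measurable_fst.aemeasurable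
  set π := η.map Prod.fst with hπ
  have hη : ∀ A B, MeasurableSet A → MeasurableSet B →
      η (B ×ˢ A) = ∫⁻ x in A, η.condKernel x B ∂π := by
    intro A B hA hB
    have h1 : η (B ×ˢ A) = η (A ×ˢ B) := by
      conv_lhs => rw [← hsym, Measure.map_apply measurable_swap (hB.prod hA)]
      congr 1
      ext q
      simp
    rw [h1, ← Measure.setLIntegral_condKernel_eq_measure_prod hA hB]
    rfl
  have hstar : ∀ A B : Finset V, A.Nonempty → B.Nonempty → (∀ u ∈ A, ∀ w ∈ B, G.Adj u w) →
      (∃ ρ : Kernel (↥A → J) J, IsStarKernel π η.condKernel ρ) ∧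
        BipartiteSymm π η.condKernel ↥A ↥B := by
    intro A B hA hB hAB
    have hd : Disjoint A B :=
      Finset.disjoint_left.2 fun v hv hv' => G.irrefl (hAB v hv v hv')
    exact (hbip A.card B.card hA.card_pos hB.card_pos
      ⟨A, B, hd, rfl, rfl, hAB⟩).exists_isStarKernel_and_bipartiteSymm hη hA.card_pos hB.card_pos
      (Fintype.card_coe A) (Fintype.card_coe B)
  have hρ : ∀ A : Finset V, ∃ ρ : Kernel (↥A → J) J, (∀ x, IsFiniteMeasure (ρ x)) ∧
      (A = ∅ → ∀ x, ρ x = π) ∧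
      (A.Nonempty → ∀ v, (∀ u ∈ A, G.Adj u v) → IsStarKernel π η.condKernel ρ) := by
    intro A
    rcases A.eq_empty_or_nonempty with rfl | hA
    · exact ⟨Kernel.const _ π, fun x => by rw [Kernel.const_apply]; infer_instance,
        fun _ x => Kernel.const_apply _ _, fun h => absurd rfl h.ne_empty⟩
    by_cases hv : ∃ v, ∀ u ∈ A, G.Adj u v
    · obtain ⟨v, hv⟩ := hv
      obtain ⟨⟨ρ, hρ⟩, -⟩ := hstar A {v} hA (singleton_nonempty v) (by simpa using hv)
      exact ⟨ρ, hρ.finite, fun h => absurd h hA.ne_empty, fun _ _ _ => hρ⟩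
    · exact ⟨0, fun x => by rw [zero_apply]; infer_instance, fun h => absurd h hA.ne_empty,
        fun _ v h => absurd ⟨v, h⟩ hv⟩
  choose R hR hR0 hRs using hρ
  have hs : SymmOnBipartite G R π := by
    rintro A B ⟨a, ha⟩ ⟨b, hb⟩ - hAB
    exact (hstar A B ⟨a, ha⟩ ⟨b, hb⟩ hAB).2 _ _ (hRs A ⟨a, ha⟩ b fun u hu => hAB u hu b hb)
      (hRs B ⟨b, hb⟩ a fun u hu => (hAB a ha u hu).symm)
  exact ⟨sampleMarginal G R fun _ => j, isHomMeasureFamily_sampleMarginal hsym hη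
    (sampleRecursion_sampleMeasure hG (hR0 ∅ rfl) hs) (hR0 ∅ rfl)
    fun u v huv => hRs {v} (singleton_nonempty v) u (by simpa using huv.symm)⟩
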